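/- arXiv:1002.2622 — 4 statements merged into one kernel-verified Lean document; each statement's English description precedes it below -/
import Mathlib

section
/- Let ℓ ≥ 1, ℏ > 0, λ_1,...,λ_{ℓ+1} real, and ε > max_j λ_j. Define Γ_1(z|ℏ) = ℏ^{z/ℏ} Γ(z/ℏ). Then for all real x, ∫_C ∏_{j=1}^ℓ dt_j · exp(−(1/ℏ)(Σ_{j=1}^ℓ λ_j t_j + λ_{ℓ+1}(x − Σ_j t_j) + Σ_j e^{t_j} + e^{x − Σ_j t_j})) = (1/2πℏ) ∫_{R−iε} dH · e^{−(i/ℏ) x H} ∏_{j=1}^{ℓ+1} Γ_1(iH − λ_j | ℏ), where C is a suitable shift of R^ℓ ⊂ C^ℓ making the left integral absolutely convergent. -/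
open Complex Real MeasureTheory Finset

/-- The modified Gamma function `Γ₁(z|ℏ) = ℏ^{z/ℏ} Γ(z/ℏ)`. -/
noncomputable def Gamma1 (z : ℂ) (h : ℝ) : ℂ :=
  ((h : ℂ)) ^ (z / (h : ℂ)) * Complex.Gamma (z / (h : ℂ))

/-- The Givental integrand for `ℙ^ℓ`, evaluated on the shifted contour
`t ↦ t + i c`, `t ∈ ℝ^ℓ`. -/
noncomputable def giventalIntegrand (ℓ : ℕ) (h : ℝ) (lam : Fin (ℓ + 1) → ℝ)
    (x : ℝ) (c : Fin ℓ → ℝ) (t : Fin ℓ → ℝ) : ℂ :=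
  Complex.exp (-(1 / (h : ℂ)) *
    ((∑ j : Fin ℓ, (lam j.castSucc : ℂ) * ((t j : ℂ) + Complex.I * (c j : ℂ)))
      + (lam (Fin.last ℓ) : ℂ) *
          ((x : ℂ) - ∑ j : Fin ℓ, ((t j : ℂ) + Complex.I * (c j : ℂ)))
      + (∑ j : Fin ℓ, Complex.exp ((t j : ℂ) + Complex.I * (c j : ℂ)))
      + Complex.exp ((x : ℂ) - ∑ j : Fin ℓ, ((t j : ℂ) + Complex.I * (c j : ℂ)))))


namespace GMB

lemma mellinConv {h : ℝ} (hh : 0 < h) {z : ℂ} (hz : 0 < z.re) :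
    MellinConvergent (fun u : ℝ => cexp (-(((h⁻¹ : ℝ) : ℂ) * (u : ℂ)))) z := by
  have h1 : MellinConvergent (fun u : ℝ => cexp (-(u : ℂ))) z := by
    have := Complex.GammaIntegral_convergent hz
    refine this.congr_fun (fun u _ => ?_) measurableSet_Ioi
    simp [mul_comm]
  have h2 := (MellinConvergent.comp_mul_left (f := fun u : ℝ => cexp (-(u : ℂ))) (s := z)
    (inv_pos.2 hh)).2 h1
  simpa using h2

lemma mellin_eq {h : ℝ} (hh : 0 < h) {z : ℂ} (hz : 0 < z.re) :
    mellin (fun u : ℝ => cexp (-(((h⁻¹ : ℝ) : ℂ) * (u : ℂ)))) z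
      = (h : ℂ) ^ z * Complex.Gamma z := by
  have := Complex.integral_cpow_mul_exp_neg_mul_Ioi hz (inv_pos.2 hh)
  simp only [mellin, smul_eq_mul]
  rw [this]
  simp

lemma exp_image : Real.exp '' Set.univ = Set.Ioi 0 := by
  rw [Set.image_univ, Real.range_exp]

lemma exp_aux (h : ℝ) (z : ℂ) (t : ℝ) :
    |Real.exp t| • (((Real.exp t : ℝ) : ℂ) ^ (z - 1) •
      cexp (-(((h⁻¹ : ℝ) : ℂ) * ((Real.exp t : ℝ) : ℂ))))
      = cexp (z * t - cexp t / h) := by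
  rw [abs_of_pos (Real.exp_pos t), Complex.real_smul, smul_eq_mul,
    Complex.cpow_def_of_ne_zero (by exact_mod_cast (Real.exp_pos t).ne'),
    ← Complex.ofReal_log (Real.exp_pos t).le, Real.log_exp, Complex.ofReal_exp,
    ← Complex.exp_add, ← Complex.exp_add]
  congr 1
  push_cast
  ring

lemma g_integrable {h : ℝ} (hh : 0 < h) {z : ℂ} (hz : 0 < z.re) :
    Integrable (fun t : ℝ => cexp (z * t - cexp t / h)) := by
  have h1 := mellinConv hh hz
  rw [MellinConvergent, ← exp_image, integrableOn_image_iff_integrableOn_abs_deriv_smul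
      MeasurableSet.univ (fun x _ => (Real.hasDerivAt_exp x).hasDerivWithinAt)
      Real.exp_injective.injOn] at h1
  simp_rw [exp_aux] at h1
  simpa using h1

lemma g_integral {h : ℝ} (hh : 0 < h) {z : ℂ} (hz : 0 < z.re) :
    ∫ t : ℝ, cexp (z * t - cexp t / h) = (h : ℂ) ^ z * Complex.Gamma z := by
  rw [← mellin_eq hh hz, mellin, ← exp_image, integral_image_eq_integral_abs_deriv_smul
      MeasurableSet.univ (fun x _ => (Real.hasDerivAt_exp x).hasDerivWithinAt)
      Real.exp_injective.injOn]
  simp_rw [exp_aux]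
  simp

lemma M_bound {h : ℝ} (hh : 0 < h) {z : ℂ} (hz : 0 < z.re) :
    ‖(h : ℂ) ^ z * Complex.Gamma z‖ ≤ ∫ t : ℝ, ‖cexp ((z.re : ℂ) * t - cexp t / h)‖ := by
  rw [← g_integral hh hz]
  refine (norm_integral_le_integral_norm _).trans (le_of_eq ?_)
  congr 1
  ext t
  simp [Complex.norm_exp]

lemma M_cont {h : ℝ} (hh : 0 < h) {a : ℝ} (ha : 0 < a) :
    Continuous (fun y : ℝ => (h : ℂ) ^ ((a : ℂ) + y * I) * Complex.Gamma ((a : ℂ) + y * I)) := by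
  refine Continuous.mul ?_ ?_
  · refine Continuous.const_cpow (by fun_prop) (Or.inl (by exact_mod_cast hh.ne'))
  · refine continuous_iff_continuousAt.2 fun y => ?_
    have hd : ContinuousAt Complex.Gamma ((a : ℂ) + y * I) := by
      refine (Complex.differentiableAt_Gamma _ fun m hm => ?_).continuousAt
      have := congrArg Complex.re hm
      simp at this
      have h0 : (0 : ℝ) ≤ m := Nat.cast_nonneg m
      linarith
    exact ContinuousAt.comp (f := fun y : ℝ => (a : ℂ) + y * I) hd (by fun_prop)

lemma M_integrable {h : ℝ} (hh : 0 < h) {a : ℝ} (ha : 0 < a) :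
    Integrable (fun y : ℝ =>
      (h : ℂ) ^ ((a : ℂ) + y * I) * Complex.Gamma ((a : ℂ) + y * I)) := by
  set C : ℝ := ∫ t : ℝ, ‖cexp (((a + 2 : ℝ) : ℂ) * t - cexp t / h)‖ with hC
  have hC0 : 0 ≤ C := integral_nonneg fun _ => norm_nonneg _
  have hi : Integrable (fun y : ℝ => (C * (h ^ 2)⁻¹ * (1 + (a ^ 2)⁻¹)) * (1 + y ^ 2)⁻¹) :=
    integrable_inv_one_add_sq.const_mul _
  refine hi.mono' (M_cont hh ha).aestronglyMeasurable (Filter.Eventually.of_forall fun y => ?_)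
  set z : ℂ := (a : ℂ) + y * I with hzdef
  have hre : z.re = a := by simp [hzdef]
  have him : z.im = y := by simp [hzdef]
  have hz0 : z ≠ 0 := fun hz => by rw [hz] at hre; simp at hre; linarith
  have hz1 : z + 1 ≠ 0 := fun hz => by
    have := congrArg Complex.re hz
    simp [hre] at this; linarith
  have hh' : (h : ℂ) ≠ 0 := by exact_mod_cast hh.ne'
  have hb := M_bound hh (z := z + 2) (by simp [hre]; linarith)
  have hre2 : (z + 2).re = a + 2 := by simp [hre]
  rw [hre2, ← hC] at hb
  have e1 : (h : ℂ) ^ (z + 2) * Complex.Gamma (z + 2)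
      = (h : ℂ) ^ 2 * (z * (z + 1)) * ((h : ℂ) ^ z * Complex.Gamma z) := by
    rw [show z + 2 = (z + 1) + 1 by ring, Complex.Gamma_add_one _ hz1, Complex.Gamma_add_one _ hz0,
      show z + 1 + 1 = z + (2 : ℕ) by push_cast; ring, Complex.cpow_add _ _ hh',
      Complex.cpow_natCast]
    ring
  rw [e1, norm_mul, norm_mul, norm_pow, Complex.norm_real, Real.norm_of_nonneg hh.le,
    norm_mul] at hb
  have n0 : ‖z‖ ^ 2 = a ^ 2 + y ^ 2 := by
    rw [← Complex.normSq_eq_norm_sq, Complex.normSq_apply, hre, him]; ring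
  have n1 : ‖z + 1‖ ^ 2 = (a + 1) ^ 2 + y ^ 2 := by
    rw [← Complex.normSq_eq_norm_sq, Complex.normSq_apply]; simp [hre, him]; ring
  have n2 : ‖z‖ ≤ ‖z + 1‖ := by
    refine le_of_sq_le_sq ?_ (norm_nonneg _)
    rw [n0, n1]; nlinarith
  have n3 : a ^ 2 + y ^ 2 ≤ ‖z‖ * ‖z + 1‖ := by
    rw [← n0, sq]; exact mul_le_mul_of_nonneg_left n2 (norm_nonneg _)
  set N := ‖(h : ℂ) ^ z * Complex.Gamma z‖ with hN
  have hN0 : 0 ≤ N := norm_nonneg _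
  have key : h ^ 2 * (a ^ 2 + y ^ 2) * N ≤ C := by
    refine le_trans ?_ hb
    gcongr
  have k2 : (1 + y ^ 2) ≤ (1 + (a ^ 2)⁻¹) * (a ^ 2 + y ^ 2) := by
    have : (1 + (a ^ 2)⁻¹) * (a ^ 2 + y ^ 2) = 1 + y ^ 2 + a ^ 2 + (a ^ 2)⁻¹ * y ^ 2 := by
      field_simp; ring
    rw [this]
    have : 0 ≤ (a ^ 2)⁻¹ * y ^ 2 := by positivity
    nlinarith [sq_nonneg a]
  rw [← div_eq_mul_inv, le_div_iff₀ (by positivity)]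
  calc N * (1 + y ^ 2) ≤ N * ((1 + (a ^ 2)⁻¹) * (a ^ 2 + y ^ 2)) := by gcongr
    _ = (h ^ 2 * (a ^ 2 + y ^ 2) * N) * (h ^ 2)⁻¹ * (1 + (a ^ 2)⁻¹) := by field_simp
    _ ≤ C * (h ^ 2)⁻¹ * (1 + (a ^ 2)⁻¹) := by gcongr

lemma inversion {h : ℝ} (hh : 0 < h) {a : ℝ} (ha : 0 < a) (v : ℝ) :
    cexp ((a : ℂ) * v - cexp v / h) = (1 / (2 * (π : ℂ))) * ∫ y : ℝ,
      cexp (-(I * v * y)) * ((h : ℂ) ^ ((a : ℂ) + y * I) * Complex.Gamma ((a : ℂ) + y * I)) := by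
  have hm : ∀ y : ℝ, mellin (fun u : ℝ => cexp (-(((h⁻¹ : ℝ) : ℂ) * (u : ℂ)))) ((a : ℂ) + y * I)
      = (h : ℂ) ^ ((a : ℂ) + y * I) * Complex.Gamma ((a : ℂ) + y * I) := fun y =>
    mellin_eq hh (by simpa using ha)
  have key := mellinInv_mellin_eq a (fun u : ℝ => cexp (-(((h⁻¹ : ℝ) : ℂ) * (u : ℂ))))
    (Real.exp_pos v) (mellinConv hh (by simpa using ha))
    (by simp only [VerticalIntegrable, hm]; exact M_integrable hh ha)
    (by fun_prop)
  simp only [mellinInv, hm] at key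
  have e1 : cexp ((a : ℂ) * v - cexp v / h)
      = cexp ((a : ℂ) * v) * cexp (-(((h⁻¹ : ℝ) : ℂ) * ((Real.exp v : ℝ) : ℂ))) := by
    rw [← Complex.exp_add]; congr 1; push_cast; ring
  rw [e1, ← key, Complex.real_smul, mul_left_comm, ← integral_const_mul]
  congr 1
  · push_cast; rfl
  · congr 1
    ext y
    rw [smul_eq_mul, ← mul_assoc, Complex.cpow_def_of_ne_zero (x := ((Real.exp v : ℝ) : ℂ))
      (by exact_mod_cast (Real.exp_pos v).ne'),
      ← Complex.ofReal_log (Real.exp_pos v).le, Real.log_exp, ← Complex.exp_add]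
    congr 2
    ring

lemma g_bound {h : ℝ} (hh : 0 < h) {a : ℝ} (ha : 0 < a) :
    ∃ B : ℝ, ∀ v : ℝ, ‖cexp ((a : ℂ) * v - cexp v / h)‖ ≤ B := by
  refine ⟨‖(1 / (2 * (π : ℂ)))‖ * ∫ y : ℝ,
    ‖((h : ℂ) ^ ((a : ℂ) + y * I) * Complex.Gamma ((a : ℂ) + y * I))‖, fun v => ?_⟩
  rw [inversion hh ha v, norm_mul]
  gcongr
  refine (norm_integral_le_integral_norm _).trans (le_of_eq ?_)
  congr 1
  ext y
  rw [norm_mul]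
  simp [Complex.norm_exp]

end GMB

/-- equality of the Givental-type integral (over a suitable shift
`C = ℝ^ℓ + i c` of `ℝ^ℓ ⊂ ℂ^ℓ` making the integral absolutely convergent) and
the Mellin–Barnes integral representation of the `ℙ^ℓ` Whittaker function. -/
theorem givental_eq_mellin_barnes
    (ℓ : ℕ) (hℓ : 1 ≤ ℓ) (h ε : ℝ) (hh : 0 < h)
    (lam : Fin (ℓ + 1) → ℝ) (hε : ∀ j, lam j < ε) (x : ℝ) :
    ∃ c : Fin ℓ → ℝ,
      Integrable (giventalIntegrand ℓ h lam x c) ∧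
      (∫ t : Fin ℓ → ℝ, giventalIntegrand ℓ h lam x c t)
      = (1 / (2 * (π : ℂ) * (h : ℂ))) *
        ∫ s : ℝ,
          Complex.exp (-(Complex.I / (h : ℂ)) * (x : ℂ) * ((s : ℂ) - Complex.I * (ε : ℂ))) *
          ∏ j : Fin (ℓ + 1),
            Gamma1 (Complex.I * ((s : ℂ) - Complex.I * (ε : ℂ)) - (lam j : ℂ)) h := by
  have hhc : (h : ℂ) ≠ 0 := by exact_mod_cast hh.ne'
  have hπ : (π : ℂ) ≠ 0 := by exact_mod_cast Real.pi_ne_zero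
  set a : Fin (ℓ + 1) → ℝ := fun j => (ε - lam j) / h with hadef
  have ha : ∀ j, 0 < a j := fun j => div_pos (sub_pos.2 (hε j)) hh
  -- the building blocks
  set g : ℝ → ℝ → ℂ := fun b t => cexp ((b : ℂ) * t - cexp t / h) with hg
  set M : ℝ → ℝ → ℂ := fun b y => (h : ℂ) ^ ((b : ℂ) + y * I) * Complex.Gamma ((b : ℂ) + y * I)
    with hM
  have gint : ∀ j, Integrable (g (a j)) := fun j =>
    GMB.g_integrable hh (z := (a j : ℂ)) (by simpa using ha j)
  have gcont : ∀ b, Continuous (g b) := fun b => by simp only [hg]; fun_prop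
  have Mint : ∀ j, Integrable (M (a j)) := fun j => GMB.M_integrable hh (ha j)
  have gM : ∀ j (y : ℝ), ∫ t : ℝ, g (a j) t * cexp (I * t * y) = M (a j) y := fun j y => by
    have := GMB.g_integral hh (z := (a j : ℂ) + y * I) (by simpa using ha j)
    simp only [hM]
    rw [← this]
    congr 1
    ext t
    simp only [hg]
    rw [← Complex.exp_add]
    congr 1
    ring
  set P : (Fin ℓ → ℝ) → ℂ := fun t => ∏ j : Fin ℓ, g (a j.castSucc) (t j) with hP
  have Pint : Integrable P := Integrable.fintype_prod (f := fun j : Fin ℓ => g (a j.castSucc))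
    (fun j => gint _)
  have form : giventalIntegrand ℓ h lam x (fun _ => 0)
      = fun t => cexp (-(ε * x / h)) *
        (g (a (Fin.last ℓ)) (x - ∑ j, t j) * P t) := by
    ext t
    simp only [giventalIntegrand, hP, hg, ← Complex.exp_sum]
    rw [← Complex.exp_add, ← Complex.exp_add]
    congr 1
    simp only [hadef, Complex.ofReal_zero, mul_zero, add_zero]
    push_cast
    rw [Finset.sum_sub_distrib, ← Finset.sum_div]
    have : ∑ j : Fin ℓ, (((ε : ℂ) - lam j.castSucc) / h) * (t j : ℂ)
        = (ε * ∑ j, (t j : ℂ) - ∑ j : Fin ℓ, (lam j.castSucc : ℂ) * t j) / h := by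
      rw [Finset.mul_sum, ← Finset.sum_sub_distrib, Finset.sum_div]
      refine Finset.sum_congr rfl fun j _ => ?_
      ring
    rw [this]
    field_simp
    ring
  have Gint : Integrable (fun t : Fin ℓ → ℝ => g (a (Fin.last ℓ)) (x - ∑ j, t j) * P t) := by
    obtain ⟨B, hB⟩ := GMB.g_bound hh (ha (Fin.last ℓ))
    refine Pint.bdd_mul (c := B) ?_ (Filter.Eventually.of_forall fun t => hB _)
    exact ((gcont _).comp (by fun_prop)).aestronglyMeasurable
  refine ⟨fun _ => 0, ?_, ?_⟩
  · rw [form]; exact Gint.const_mul _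
  rw [form, integral_const_mul]
  -- Mellin inversion for the last factor
  have step1 : ∀ t : Fin ℓ → ℝ, g (a (Fin.last ℓ)) (x - ∑ j, t j) * P t
      = (1 / (2 * (π : ℂ))) * ∫ y : ℝ,
        cexp (-(I * ((x - ∑ j, t j : ℝ) : ℂ) * y)) * (P t * M (a (Fin.last ℓ)) y) := fun t => by
    simp only [hg]
    rw [GMB.inversion hh (ha (Fin.last ℓ)), mul_assoc, ← integral_mul_const]
    congr 2
    ext y
    simp only [hM]
    ring
  simp_rw [step1]
  rw [integral_const_mul]
  have Kint : Integrable (Function.uncurry (fun (t : Fin ℓ → ℝ) (y : ℝ) =>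
      cexp (-(I * ((x - ∑ j, t j : ℝ) : ℂ) * y)) * (P t * M (a (Fin.last ℓ)) y)))
      (volume.prod volume) := by
    refine (Pint.mul_prod (Mint (Fin.last ℓ))).bdd_mul (c := 1)
      (f := fun p : (Fin ℓ → ℝ) × ℝ => cexp (-(I * ((x - ∑ j, p.1 j : ℝ) : ℂ) * p.2))) ?_
      (Filter.Eventually.of_forall fun p => ?_)
    · refine Continuous.aestronglyMeasurable ?_
      fun_prop
    · rw [Complex.norm_exp]
      refine le_of_eq ?_
      generalize x - ∑ j, p.1 j = v
      simp
  rw [integral_integral_swap Kint]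
  have step2 : ∀ y : ℝ, ∫ t : Fin ℓ → ℝ,
      cexp (-(I * ((x - ∑ j, t j : ℝ) : ℂ) * y)) * (P t * M (a (Fin.last ℓ)) y)
      = cexp (-(I * x * y)) * ∏ j : Fin (ℓ + 1), M (a j) y := fun y => by
    have e : ∀ t : Fin ℓ → ℝ,
        cexp (-(I * ((x - ∑ j, t j : ℝ) : ℂ) * y)) * (P t * M (a (Fin.last ℓ)) y)
        = (cexp (-(I * x * y)) * M (a (Fin.last ℓ)) y) *
          ∏ j : Fin ℓ, (g (a j.castSucc) (t j) * cexp (I * t j * y)) := fun t => by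
      rw [Finset.prod_mul_distrib,
        ← Complex.exp_sum Finset.univ (fun j : Fin ℓ => I * (t j : ℂ) * (y : ℂ))]
      have : cexp (-(I * ((x - ∑ j, t j : ℝ) : ℂ) * y))
          = cexp (-(I * x * y)) * cexp (∑ j : Fin ℓ, I * t j * y) := by
        rw [← Complex.exp_add, ← Finset.sum_mul, ← Finset.mul_sum]
        congr 1
        push_cast
        ring
      rw [this]
      simp only [hP]
      ring
    simp_rw [e]
    rw [integral_const_mul, integral_fintype_prod_volume_eq_prod
      (fun (j : Fin ℓ) (u : ℝ) => g (a j.castSucc) u * cexp (I * u * y)), Fin.prod_univ_castSucc]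
    simp_rw [gM]
    ring
  simp_rw [step2]
  -- rescaling
  have step3 : ∀ s : ℝ,
      cexp (-(I / (h : ℂ)) * (x : ℂ) * ((s : ℂ) - I * (ε : ℂ))) *
          ∏ j : Fin (ℓ + 1), Gamma1 (I * ((s : ℂ) - I * (ε : ℂ)) - (lam j : ℂ)) h
      = cexp (-(ε * x / h)) * (fun y : ℝ => cexp (-(I * x * y)) *
          ∏ j : Fin (ℓ + 1), M (a j) y) (s / h) := fun s => by
    simp only []
    rw [← mul_assoc, ← Complex.exp_add]
    congr 1
    · congr 1
      push_cast
      field_simp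
      linear_combination (x * ε : ℂ) * Complex.I_sq
    · refine Finset.prod_congr rfl fun j _ => ?_
      simp only [Gamma1, hM]
      have : (I * ((s : ℂ) - I * (ε : ℂ)) - (lam j : ℂ)) / h = (a j : ℂ) + ((s / h : ℝ) : ℂ) * I := by
        simp only [hadef]
        push_cast
        field_simp
        linear_combination (-ε : ℂ) * Complex.I_sq
      rw [this]
  simp_rw [step3]
  rw [integral_const_mul, Measure.integral_comp_div
    (fun y : ℝ => cexp (-(I * x * y)) * ∏ j : Fin (ℓ + 1), M (a j) y) h, abs_of_pos hh,
    Complex.real_smul]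
  field_simp
end

section
/- Let ℏ > 0, λ_1,...,λ_{ℓ+1} real, ε > max_j λ_j, and define Φ(x) = (1/2πℏ) ∫_{R−iε} dH e^{−(i/ℏ)xH} ∏_{j=1}^{ℓ+1} Γ_1(iH − λ_j | ℏ) with Γ_1(z|ℏ) = ℏ^{z/ℏ}Γ(z/ℏ). Then Φ is smooth and satisfies the differential equation (∏_{j=1}^{ℓ+1}(−ℏ ∂_x − λ_j) − e^x) Φ(x) = 0. -/
open Complex Real MeasureTheory Finset

/-- Application of the ordered product of first order operators
`∏_j (-ℏ ∂_x - λ_j)` to a function `f : ℝ → ℂ`. -/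
noncomputable def todaOp (h : ℝ) (lams : List ℝ) (f : ℝ → ℂ) : ℝ → ℂ :=
  lams.foldr (fun l g x => -(h : ℂ) * deriv g x - (l : ℂ) * g x) f

open Filter Topology

lemma mb_norm_Gamma_le (z : ℂ) (hz : 0 < z.re) : ‖Complex.Gamma z‖ ≤ Real.Gamma z.re := by
  rw [Complex.Gamma_eq_integral hz, Complex.GammaIntegral, Real.Gamma_eq_integral hz]
  refine (norm_integral_le_integral_norm _).trans (le_of_eq ?_)
  refine setIntegral_congr_fun measurableSet_Ioi fun x hx => ?_
  have hx' : (0 : ℝ) < x := hx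
  simp only [norm_mul, Complex.norm_real, Real.norm_eq_abs, abs_of_pos (Real.exp_pos _)]
  rw [Complex.norm_cpow_eq_rpow_re_of_pos hx']
  simp

lemma mb_Gamma1_add (z : ℂ) (h : ℝ) (hh : 0 < h) (hz : z ≠ 0) :
    Gamma1 (z + h) h = z * Gamma1 z h := by
  have hc : (h : ℂ) ≠ 0 := by exact_mod_cast hh.ne'
  unfold Gamma1
  rw [add_div, div_self hc, Complex.Gamma_add_one _ (div_ne_zero hz hc), Complex.cpow_add _ _ hc,
    Complex.cpow_one]
  field_simp

lemma mb_norm_Gamma1_le (z : ℂ) (h : ℝ) (hh : 0 < h) (hz : 0 < z.re) :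
    ‖Gamma1 z h‖ ≤ h ^ (z.re / h) * Real.Gamma (z.re / h) := by
  unfold Gamma1
  have hre : (z / (h : ℂ)).re = z.re / h := by simp
  rw [norm_mul, Complex.norm_cpow_eq_rpow_re_of_pos hh, hre]
  have := mb_norm_Gamma_le (z / (h : ℂ)) (by rw [hre]; positivity)
  rw [hre] at this
  gcongr

lemma mb_pow_norm_Gamma1_le (h : ℝ) (hh : 0 < h) (n : ℕ) : ∀ (z : ℂ) (_ : 0 < z.re),
    ‖z‖ ^ n * ‖Gamma1 z h‖ ≤ h ^ ((z.re + n * h) / h) * Real.Gamma ((z.re + n * h) / h) := by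
  induction n with
  | zero => intro z hz; simpa using mb_norm_Gamma1_le z h hh hz
  | succ n ih =>
    intro z hz
    have hz0 : z ≠ 0 := by rintro rfl; simp at hz
    have hre : (z + (h : ℂ)).re = z.re + h := by simp
    have h1 := ih (z + h) (by rw [hre]; positivity)
    rw [mb_Gamma1_add z h hh hz0, hre, norm_mul] at h1
    have h2 : ‖z‖ ≤ ‖z + (h : ℂ)‖ := by
      rw [Complex.norm_def, Complex.norm_def]
      apply Real.sqrt_le_sqrt
      simp only [Complex.normSq_apply, Complex.add_re, Complex.add_im, Complex.ofReal_re,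
        Complex.ofReal_im]
      nlinarith
    have h3 : ‖z‖ ^ n ≤ ‖z + (h : ℂ)‖ ^ n := by gcongr
    have e : z.re + ((n + 1 : ℕ) : ℝ) * h = z.re + h + n * h := by push_cast; ring
    rw [e]
    refine le_trans ?_ h1
    rw [pow_succ, mul_assoc]
    gcongr

lemma mb_Gamma1_bound (h a b : ℝ) (hh : 0 < h) (ha : 0 < a) (n : ℕ) :
    ∃ C : ℝ, 0 ≤ C ∧ ∀ σ ∈ Set.Icc a b, ∀ s : ℝ,
      (1 + |s|) ^ n * ‖Gamma1 ((σ : ℂ) + s * Complex.I) h‖ ≤ C := by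
  have hcont : ContinuousOn
      (fun σ : ℝ => h ^ ((σ + n * h) / h) * Real.Gamma ((σ + n * h) / h)) (Set.Icc a b) := by
    intro σ hσ
    have hp : 0 < (σ + n * h) / h := by
      have := hσ.1
      have : 0 < σ := by linarith
      positivity
    apply ContinuousAt.continuousWithinAt
    apply ContinuousAt.mul
    · exact ContinuousAt.rpow continuousAt_const (by fun_prop) (Or.inl hh.ne')
    · have hd : ContinuousAt Real.Gamma ((σ + n * h) / h) :=
        (Real.differentiableAt_Gamma (fun m hm => by
          have : (0:ℝ) ≤ m := by positivity
          linarith)).continuousAt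
      exact ContinuousAt.comp (f := fun σ : ℝ => (σ + n * h) / h) hd (by fun_prop)
  obtain ⟨C, hC⟩ := isCompact_Icc.exists_bound_of_continuousOn hcont
  refine ⟨(1 + 1 / a) ^ n * |C|, by positivity, fun σ hσ s => ?_⟩
  set z : ℂ := (σ : ℂ) + s * Complex.I with hzdef
  have hre : z.re = σ := by simp [hzdef]
  have him : z.im = s := by simp [hzdef]
  have hσ0 : 0 < σ := lt_of_lt_of_le ha hσ.1
  have h1 := mb_pow_norm_Gamma1_le h hh n z (by rw [hre]; exact hσ0)
  rw [hre] at h1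
  have h2 : ‖z‖ ^ n * ‖Gamma1 z h‖ ≤ |C| :=
    h1.trans ((le_abs_self _).trans ((hC σ hσ).trans (le_abs_self _)))
  have hs : |s| ≤ ‖z‖ := by rw [← him]; exact Complex.abs_im_le_norm z
  have haz : a ≤ ‖z‖ := by
    refine hσ.1.trans ?_
    rw [← hre]; exact Complex.re_le_norm z
  have h3 : 1 + |s| ≤ (1 + 1 / a) * ‖z‖ := by
    have : 1 ≤ 1 / a * ‖z‖ := by
      rw [one_div, inv_mul_eq_div, le_div_iff₀ ha]; linarith
    linarith
  calc (1 + |s|) ^ n * ‖Gamma1 z h‖ ≤ ((1 + 1 / a) * ‖z‖) ^ n * ‖Gamma1 z h‖ := by gcongr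
    _ = (1 + 1 / a) ^ n * (‖z‖ ^ n * ‖Gamma1 z h‖) := by rw [mul_pow]; ring
    _ ≤ _ := by gcongr

/-- The product of Gamma factors. -/
noncomputable def mbProd {m : ℕ} (h : ℝ) (lam : Fin m → ℝ) (z : ℂ) : ℂ :=
  ∏ j, Gamma1 (z - (lam j : ℂ)) h

lemma mbProd_bound {m : ℕ} (h a b : ℝ) (hh : 0 < h) (lam : Fin (m + 1) → ℝ)
    (ha : ∀ j, lam j < a) (n : ℕ) :
    ∃ C : ℝ, 0 ≤ C ∧ ∀ σ ∈ Set.Icc a b, ∀ s : ℝ,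
      (1 + |s|) ^ n * ‖mbProd h lam ((σ : ℂ) + s * Complex.I)‖ ≤ C := by
  choose C hC0 hC using fun j => mb_Gamma1_bound h (a - lam j) (b - lam j) hh
    (sub_pos.2 (ha j)) n
  refine ⟨∏ j, C j, Finset.prod_nonneg fun j _ => hC0 j, fun σ hσ s => ?_⟩
  have h1 : ∏ j, ((1 + |s|) ^ n * ‖Gamma1 ((σ : ℂ) + s * Complex.I - lam j) h‖) ≤ ∏ j, C j := by
    apply Finset.prod_le_prod
    · intro j _; positivity
    · intro j _
      have := hC j (σ - lam j) ⟨by linarith [hσ.1], by linarith [hσ.2]⟩ s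
      have e : ((σ - lam j : ℝ) : ℂ) + s * Complex.I = (σ : ℂ) + s * Complex.I - lam j := by
        push_cast; ring
      rwa [e] at this
  refine le_trans ?_ h1
  rw [Finset.prod_mul_distrib, mbProd, norm_prod]
  gcongr
  rw [Finset.prod_const, Finset.card_univ, Fintype.card_fin]
  apply le_self_pow₀
  · apply one_le_pow₀; linarith [abs_nonneg s]
  · omega

lemma mb_Gamma1_diff (h : ℝ) (hh : 0 < h) (z : ℂ) (hz : 0 < z.re) :
    DifferentiableAt ℂ (fun z => Gamma1 z h) z := by
  have hc : (h : ℂ) ≠ 0 := by exact_mod_cast hh.ne'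
  unfold Gamma1
  have hd : DifferentiableAt ℂ Complex.Gamma (z / h) := by
    apply Complex.differentiableAt_Gamma
    intro m hm
    have h1 := congrArg Complex.re hm
    simp at h1
    have : 0 < z.re / h := by positivity
    have : (0:ℝ) ≤ m := by positivity
    linarith
  apply DifferentiableAt.mul
  · exact DifferentiableAt.const_cpow (by fun_prop) (Or.inl hc)
  · exact DifferentiableAt.comp (f := fun z : ℂ => z / h) z hd (by fun_prop)

lemma mbProd_diff {m : ℕ} (h : ℝ) (hh : 0 < h) (lam : Fin m → ℝ) (z : ℂ)
    (hz : ∀ j, lam j < z.re) : DifferentiableAt ℂ (mbProd h lam) z := by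
  unfold mbProd
  apply DifferentiableAt.fun_finsetProd
  intro j _
  exact DifferentiableAt.comp (g := fun z => Gamma1 z h) (f := fun z : ℂ => z - lam j) z
    (mb_Gamma1_diff h hh _ (by simpa using hz j)) (by fun_prop)

lemma mb_integrable_of_bound (f : ℝ → ℂ) (hf : Continuous f) (C : ℝ)
    (hb : ∀ s, (1 + |s|) ^ 2 * ‖f s‖ ≤ C) : Integrable f := by
  have h1 : Integrable (fun s : ℝ => (1 + ‖s‖) ^ (-(2:ℝ))) :=
    integrable_one_add_norm (by simp)
  refine (h1.const_mul C).mono' hf.aestronglyMeasurable (Eventually.of_forall fun s => ?_)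
  have hp : 0 < 1 + |s| := by positivity
  rw [Real.rpow_neg (by positivity), Real.norm_eq_abs, Real.rpow_ofNat, ← div_eq_mul_inv,
    le_div_iff₀ (by positivity), mul_comm]
  exact hb s

/-- Shift of the vertical contour. -/
lemma mb_shift (f : ℂ → ℂ) (a b : ℝ) (hab : a ≤ b)
    (hd : ∀ z : ℂ, z.re ∈ Set.Icc a b → DifferentiableAt ℂ f z) (C : ℝ)
    (hb : ∀ σ ∈ Set.Icc a b, ∀ s : ℝ, (1 + |s|) ^ 2 * ‖f ((σ : ℂ) + s * Complex.I)‖ ≤ C) :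
    ∫ s : ℝ, f ((b : ℂ) + s * Complex.I) = ∫ s : ℝ, f ((a : ℂ) + s * Complex.I) := by
  have hint : ∀ σ ∈ Set.Icc a b, Integrable (fun s : ℝ => f ((σ : ℂ) + s * Complex.I)) := by
    intro σ hσ
    refine mb_integrable_of_bound _ ?_ C (hb σ hσ)
    rw [continuous_iff_continuousAt]
    intro s
    exact ContinuousAt.comp (g := f) (f := fun s : ℝ => (σ : ℂ) + s * Complex.I)
      (hd _ (by simpa using hσ)).continuousAt (by fun_prop)
  have hA := intervalIntegral_tendsto_integral (hint a ⟨le_rfl, hab⟩) tendsto_neg_atTop_atBot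
    tendsto_id
  have hB := intervalIntegral_tendsto_integral (hint b ⟨hab, le_rfl⟩) tendsto_neg_atTop_atBot
    tendsto_id
  have hlim : Tendsto (fun T : ℝ => C / (1 + |T|) ^ 2 * |b - a|) atTop (𝓝 0) := by
    have : Tendsto (fun T : ℝ => (1 + |T|) ^ 2) atTop atTop :=
      (tendsto_pow_atTop (by norm_num)).comp
        (tendsto_atTop_add_const_left _ _ tendsto_abs_atTop_atTop)
    simpa using (tendsto_const_nhds.div_atTop this).mul_const |b - a|
  have hor : ∀ T : ℝ, ‖∫ x in a..b, f ((x : ℂ) + T * Complex.I)‖ ≤ C / (1 + |T|) ^ 2 * |b - a| := by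
    intro T
    apply intervalIntegral.norm_integral_le_of_norm_le_const
    intro x hx
    rw [Set.uIoc_of_le hab] at hx
    rw [le_div_iff₀ (by positivity), mul_comm]
    exact hb x ⟨hx.1.le, hx.2⟩ T
  have h1 : Tendsto (fun T : ℝ => ∫ x in a..b, f ((x : ℂ) + T * Complex.I)) atTop (𝓝 0) :=
    squeeze_zero_norm hor hlim
  have h2 : Tendsto (fun T : ℝ => ∫ x in a..b, f ((x : ℂ) + ((-T : ℝ) : ℂ) * Complex.I)) atTop
      (𝓝 0) :=
    squeeze_zero_norm (fun T => by simpa only [abs_neg] using hor (-T)) hlim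
  have hrect : ∀ T : ℝ, (∫ x in a..b, f ((x : ℂ) + ((-T : ℝ) : ℂ) * Complex.I))
      - (∫ x in a..b, f ((x : ℂ) + T * Complex.I))
      + Complex.I • (∫ y in (-T)..(id T), f ((b : ℂ) + y * Complex.I))
      - Complex.I • (∫ y in (-T)..(id T), f ((a : ℂ) + y * Complex.I)) = 0 := by
    intro T
    have := Complex.integral_boundary_rect_eq_zero_of_differentiableOn f ⟨a, -T⟩ ⟨b, T⟩ (by
      intro z hz
      refine (hd z ?_).differentiableWithinAt
      have := hz.1
      simpa [Set.uIcc_of_le hab] using this)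
    simpa using this
  have hall := ((h2.sub h1).add (hB.const_smul Complex.I)).sub (hA.const_smul Complex.I)
  have h0 := tendsto_nhds_unique (hall.congr hrect) tendsto_const_nhds
  rw [sub_zero, zero_add, ← smul_sub] at h0
  simpa [sub_eq_zero] using h0

/-- The Fourier-type integral with amplitude `F` along the line of real part `ε`. -/
noncomputable def mbI (h ε : ℝ) (F : ℝ → ℂ) (x : ℝ) : ℂ :=
  ∫ s : ℝ, Complex.exp (-(((ε : ℂ) + s * Complex.I) / h) * x) * F s

def mbRD (ε : ℝ) (F : ℝ → ℂ) : Prop :=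
  ∀ n : ℕ, Integrable (fun s : ℝ => ((ε : ℂ) + s * Complex.I) ^ n * F s)

lemma mbRD.mulw {ε : ℝ} {F : ℝ → ℂ} (hF : mbRD ε F) (c d : ℂ) :
    mbRD ε (fun s => (c * ((ε : ℂ) + s * Complex.I) + d) * F s) := by
  intro n
  refine (((hF (n + 1)).const_mul c).add ((hF n).const_mul d)).congr
    (Eventually.of_forall fun s => ?_)
  simp only [Pi.add_apply]
  ring

lemma mb_exp_norm (h ε x s : ℝ) :
    ‖Complex.exp (-(((ε : ℂ) + s * Complex.I) / h) * x)‖ = Real.exp (-(ε / h) * x) := by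
  rw [Complex.norm_exp]
  congr 1
  have : (-(((ε : ℂ) + s * Complex.I) / h) * x) =
    ((-(ε / h) * x : ℝ) : ℂ) + ((-(s / h) * x : ℝ) : ℂ) * Complex.I := by push_cast; ring
  rw [this]; simp

lemma mb_integrable {h ε : ℝ} {F : ℝ → ℂ} (hF : Integrable F) (x : ℝ) :
    Integrable (fun s : ℝ => Complex.exp (-(((ε : ℂ) + s * Complex.I) / h) * x) * F s) := by
  refine hF.bdd_mul (c := Real.exp (-(ε / h) * x)) (Continuous.aestronglyMeasurable (by fun_prop))
    (Eventually.of_forall fun s => (mb_exp_norm h ε x s).le)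

lemma mbI_hasDeriv {h ε : ℝ} {F : ℝ → ℂ} (hF : mbRD ε F) (x : ℝ) :
    HasDerivAt (mbI h ε F)
      (mbI h ε (fun s => (-(1 / (h : ℂ)) * ((ε : ℂ) + s * Complex.I) + 0) * F s) x) x := by
  have h0 : Integrable F := by simpa using hF 0
  have h1 : Integrable (fun s : ℝ => (-(1 / (h : ℂ)) * ((ε : ℂ) + s * Complex.I) + 0) * F s) := by
    simpa using (hF.mulw (-(1 / (h : ℂ))) 0) 0
  refine (hasDerivAt_integral_of_dominated_loc_of_deriv_le (𝕜 := ℝ)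
    (F := fun (x : ℝ) (s : ℝ) => Complex.exp (-(((ε : ℂ) + s * Complex.I) / h) * x) * F s)
    (F' := fun (x : ℝ) (s : ℝ) => Complex.exp (-(((ε : ℂ) + s * Complex.I) / h) * x) *
      ((-(1 / (h : ℂ)) * ((ε : ℂ) + s * Complex.I) + 0) * F s))
    (bound := fun s => Real.exp (|ε / h| * (|x| + 1)) *
      ‖(-(1 / (h : ℂ)) * ((ε : ℂ) + s * Complex.I) + 0) * F s‖)
    (s := Metric.ball x 1) (Metric.ball_mem_nhds x one_pos)
    (Eventually.of_forall fun y => (mb_integrable h0 y).aestronglyMeasurable)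
    (mb_integrable h0 x) (mb_integrable h1 x).aestronglyMeasurable ?_ (h1.norm.const_mul _) ?_).2
  · refine Eventually.of_forall fun s y hy => ?_
    rw [norm_mul, mb_exp_norm]
    refine mul_le_mul_of_nonneg_right (Real.exp_le_exp.2 ?_) (norm_nonneg _)
    rw [Metric.mem_ball, Real.dist_eq] at hy
    have : |y| ≤ |x| + 1 := by
      have := abs_sub_abs_le_abs_sub y x
      linarith
    calc -(ε / h) * y ≤ |-(ε / h) * y| := le_abs_self _
      _ = |ε / h| * |y| := by rw [abs_mul, abs_neg]
      _ ≤ _ := by gcongr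
  · refine Eventually.of_forall fun s y _ => ?_
    have h2 : HasDerivAt (fun y : ℝ => -(((ε : ℂ) + s * Complex.I) / h) * (y : ℂ))
        (-(((ε : ℂ) + s * Complex.I) / h) * 1) y :=
      (Complex.ofRealCLM.hasDerivAt (x := y)).const_mul _
    have h3 := h2.cexp.mul_const (F s)
    refine h3.congr_deriv ?_
    ring

lemma mbI_contDiff_nat {h ε : ℝ} (n : ℕ) : ∀ {F : ℝ → ℂ}, mbRD ε F →
    ContDiff ℝ n (mbI h ε F) := by
  induction n with
  | zero =>
    intro F hF
    exact contDiff_zero.2 (continuous_iff_continuousAt.2 fun x => (mbI_hasDeriv hF x).continuousAt)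
  | succ n ih =>
    intro F hF
    push_cast
    rw [contDiff_succ_iff_deriv]
    refine ⟨fun x => (mbI_hasDeriv hF x).differentiableAt, by simp, ?_⟩
    rw [show deriv (mbI h ε F) = _ from funext fun x => (mbI_hasDeriv hF x).deriv]
    exact ih (hF.mulw _ _)

lemma mb_todaOp {h ε : ℝ} (hh : 0 < h) (c : ℂ) {F : ℝ → ℂ} (hF : mbRD ε F) (L : List ℝ) :
    mbRD ε (fun s => (L.map fun l : ℝ => ((ε : ℂ) + s * Complex.I) - (l : ℂ)).prod * F s) ∧
    todaOp h L (fun x => c * mbI h ε F x) = fun x => c * mbI h ε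
      (fun s => (L.map fun l : ℝ => ((ε : ℂ) + s * Complex.I) - (l : ℂ)).prod * F s) x := by
  have hc : (h : ℂ) ≠ 0 := by exact_mod_cast hh.ne'
  induction L with
  | nil => simpa [todaOp] using hF
  | cons l L ih =>
    obtain ⟨ih1, ih2⟩ := ih
    have hR := ih1.mulw 1 (-(l : ℂ))
    constructor
    · convert hR using 2 with s
      simp; ring
    · funext x
      change -(h : ℂ) * deriv (todaOp h L fun x => c * mbI h ε F x) x
        - (l : ℂ) * todaOp h L (fun x => c * mbI h ε F x) x = _
      rw [ih2, ((mbI_hasDeriv ih1 x).const_mul c).deriv]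
      have i0 := mb_integrable (h := h) (ε := ε) (by simpa using ih1 0) x
      have i1 := mb_integrable (h := h) (ε := ε)
        (by simpa only [pow_zero, one_mul] using (ih1.mulw (-(1 / (h : ℂ))) 0) 0) x
      have : ∀ A B : ℂ, -(h : ℂ) * (c * A) - l * (c * B) = c * (-(h : ℂ) * A - l * B) := by
        intros; ring
      rw [this]
      congr 1
      unfold mbI
      rw [← integral_const_mul, ← integral_const_mul, ← integral_sub (i1.const_mul _)
        (i0.const_mul _)]
      congr 1
      funext s
      simp only [List.map_cons, List.prod_cons]
      field_simp
      ring

lemma mbProd_RD {m : ℕ} (h ε : ℝ) (hh : 0 < h) (lam : Fin (m + 1) → ℝ) (hε : ∀ j, lam j < ε) :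
    mbRD ε (fun s => mbProd h lam ((ε : ℂ) + s * Complex.I)) := by
  intro n
  obtain ⟨C, hC0, hC⟩ := mbProd_bound h ε ε hh lam hε (n + 2)
  refine mb_integrable_of_bound _ ?_ ((1 + |ε|) ^ n * C) fun s => ?_
  · rw [continuous_iff_continuousAt]
    intro s
    refine ContinuousAt.mul (by fun_prop) ?_
    exact ContinuousAt.comp (g := mbProd h lam) (f := fun s : ℝ => (ε : ℂ) + s * Complex.I)
      (mbProd_diff h hh lam _ (by simpa using hε)).continuousAt (by fun_prop)
  · have h1 : ‖(ε : ℂ) + s * Complex.I‖ ≤ (1 + |ε|) * (1 + |s|) := by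
      refine (norm_add_le _ _).trans ?_
      simp only [norm_mul, Complex.norm_real, Complex.norm_I, Real.norm_eq_abs, mul_one]
      nlinarith [abs_nonneg ε, abs_nonneg s, mul_nonneg (abs_nonneg ε) (abs_nonneg s)]
    have h2 := hC ε ⟨le_rfl, le_rfl⟩ s
    rw [norm_mul, norm_pow]
    calc (1 + |s|) ^ 2 * (‖(ε : ℂ) + s * Complex.I‖ ^ n * ‖mbProd h lam ((ε : ℂ) + s * Complex.I)‖)
        ≤ (1 + |s|) ^ 2 * (((1 + |ε|) * (1 + |s|)) ^ n *
          ‖mbProd h lam ((ε : ℂ) + s * Complex.I)‖) := by gcongr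
      _ = (1 + |ε|) ^ n * ((1 + |s|) ^ (n + 2) *
          ‖mbProd h lam ((ε : ℂ) + s * Complex.I)‖) := by rw [mul_pow]; ring
      _ ≤ _ := by gcongr

lemma mb_final {m : ℕ} (h ε : ℝ) (hh : 0 < h) (lam : Fin (m + 1) → ℝ) (hε : ∀ j, lam j < ε)
    (x : ℝ) :
    mbI h ε (fun s => ((List.ofFn lam).map fun l : ℝ => ((ε : ℂ) + s * Complex.I) - (l : ℂ)).prod *
      mbProd h lam ((ε : ℂ) + s * Complex.I)) x =
    Real.exp x * mbI h ε (fun s => mbProd h lam ((ε : ℂ) + s * Complex.I)) x := by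
  have hc : (h : ℂ) ≠ 0 := by exact_mod_cast hh.ne'
  obtain ⟨C, hC0, hC⟩ := mbProd_bound h ε (ε + h) hh lam hε 2
  set M : ℝ := Real.exp (|x| / h * (|ε| + h)) with hM
  have hs := mb_shift (fun z => Complex.exp (-(z / h) * x) * mbProd h lam z) ε (ε + h)
    (by linarith) (fun z hz => by
      refine DifferentiableAt.mul (by fun_prop) (mbProd_diff h hh lam z fun j => ?_)
      exact (hε j).trans_le hz.1) (M * C) (by
      intro σ hσ s
      rw [norm_mul, mb_exp_norm]
      have h1 := hC σ hσ s
      have hσ' : |σ| ≤ |ε| + h := by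
        rw [abs_le]
        constructor
        · linarith [hσ.1, neg_abs_le ε]
        · linarith [hσ.2, le_abs_self ε]
      have h2 : Real.exp (-(σ / h) * x) ≤ M := by
        rw [hM]
        refine Real.exp_le_exp.2 ?_
        calc -(σ / h) * x ≤ |-(σ / h) * x| := le_abs_self _
          _ = |x| / h * |σ| := by rw [abs_mul, abs_neg, abs_div, abs_of_pos hh]; ring
          _ ≤ _ := by gcongr
      calc _ = Real.exp (-(σ / h) * x) * ((1 + |s|) ^ 2 *
            ‖mbProd h lam ((σ : ℂ) + s * Complex.I)‖) := by ring
        _ ≤ M * C := by gcongr)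
  unfold mbI
  rw [← hs, ← integral_const_mul]
  congr 1
  funext s
  have e1 : ((List.ofFn lam).map fun l : ℝ => ((ε : ℂ) + s * Complex.I) - (l : ℂ)).prod *
      mbProd h lam ((ε : ℂ) + s * Complex.I) =
      mbProd h lam (((ε + h : ℝ) : ℂ) + s * Complex.I) := by
    rw [List.map_ofFn, List.prod_ofFn]
    unfold mbProd
    rw [← Finset.prod_mul_distrib]
    refine Finset.prod_congr rfl fun j _ => ?_
    have : ((ε : ℂ) + s * Complex.I - lam j) ≠ 0 := by
      intro h0
      have := congrArg Complex.re h0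
      simp at this
      linarith [hε j]
    rw [Function.comp_apply, ← mb_Gamma1_add _ h hh this]
    congr 1
    push_cast; ring
  beta_reduce
  rw [e1, ← mul_assoc, Complex.ofReal_exp, ← Complex.exp_add]
  congr 2
  push_cast
  field_simp
  ring

/-- the Mellin–Barnes integral
`Φ(x) = (1/2πℏ) ∫_{ℝ-iε} e^{-(i/ℏ)xH} ∏_j Γ₁(iH-λ_j|ℏ) dH` is smooth and
satisfies the quantum differential equation
`(∏_{j=1}^{ℓ+1}(-ℏ∂_x - λ_j) - e^x) Φ = 0` of `ℙ^ℓ`. -/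
theorem mellin_barnes_solves_quantum_de
    (ℓ : ℕ) (h ε : ℝ) (hh : 0 < h)
    (lam : Fin (ℓ + 1) → ℝ) (hε : ∀ j, lam j < ε) :
    let Φ : ℝ → ℂ := fun x =>
      (1 / (2 * (π : ℂ) * (h : ℂ))) *
        ∫ s : ℝ,
          Complex.exp (-(Complex.I / (h : ℂ)) * (x : ℂ) * ((s : ℂ) - Complex.I * (ε : ℂ))) *
          ∏ j : Fin (ℓ + 1),
            Gamma1 (Complex.I * ((s : ℂ) - Complex.I * (ε : ℂ)) - (lam j : ℂ)) h
    ContDiff ℝ (⊤ : ℕ∞) Φ ∧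
      ∀ x : ℝ, todaOp h (List.ofFn lam) Φ x - Real.exp x * Φ x = 0 := by
  intro Φ
  have hΦ : Φ = fun x => (1 / (2 * (π : ℂ) * (h : ℂ))) *
      mbI h ε (fun s => mbProd h lam ((ε : ℂ) + s * Complex.I)) x := by
    funext x
    have hw : ∀ s : ℝ, Complex.I * ((s : ℂ) - Complex.I * (ε : ℂ)) = (ε : ℂ) + s * Complex.I := by
      intro s
      have := Complex.I_mul_I
      linear_combination (-(ε : ℂ)) * this
    simp only [Φ, mbI, mbProd]
    congr 2
    funext s
    rw [← hw s]
    congr 2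
    ring
  have hR := mbProd_RD h ε hh lam hε
  constructor
  · rw [hΦ]
    refine contDiff_const.mul ?_
    exact contDiff_infty.2 fun n => mbI_contDiff_nat n hR
  · intro x
    rw [hΦ, (mb_todaOp hh _ hR (List.ofFn lam)).2]
    simp only
    rw [mb_final h ε hh lam hε x]
    ring
end

section
/- Gustafson's first beta-type identity (degenerate case): for complex α_1, α_2, α_3 with Re(α_j) > 0 and ℏ > 0, ∫_{C_0} dt · ∏_{j=1}^3 Γ_1(α_j + t|ℏ) Γ_1(α_j − t|ℏ) / (Γ_1(2t|ℏ) Γ_1(−2t|ℏ)) = ∏_{1≤i<j≤3} Γ_1(α_i + α_j|ℏ), where Γ_1(z|ℏ) = ℏ^{z/ℏ}Γ(z/ℏ) and C_0 is a contour (e.g. the imaginary axis, suitably indented) separating the pole families {−α_i − nℏ : n ∈ Z_{≥0}} from {α_i + nℏ : n ∈ Z_{≥0}}, with the measure normalized appropriately. -/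
open Complex Real MeasureTheory Finset

namespace Gust

open Set Filter Topology

lemma norm_beta_le {z : ℂ} {r : ℝ} (hz : 0 < z.re) (hr : 0 < r) :
    ‖Complex.betaIntegral z r‖ * Real.Gamma (z.re + r) ≤ Real.Gamma z.re * Real.Gamma r := by
  have h1 : Complex.betaIntegral (z.re : ℂ) (r : ℂ)
      = ((∫ x in (0:ℝ)..1, x ^ (z.re - 1) * (1 - x) ^ (r - 1) : ℝ) : ℂ) := by
    rw [Complex.betaIntegral, ← intervalIntegral.integral_ofReal]
    apply intervalIntegral.integral_congr_ae
    filter_upwards with x hx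
    rw [uIoc_of_le zero_le_one] at hx
    push_cast
    rw [Complex.ofReal_cpow hx.1.le, Complex.ofReal_cpow (by linarith [hx.2])]
    push_cast
    rfl
  have h2 : ‖Complex.betaIntegral z r‖ ≤ ∫ x in (0:ℝ)..1, x ^ (z.re - 1) * (1 - x) ^ (r - 1) := by
    rw [Complex.betaIntegral]
    refine (intervalIntegral.norm_integral_le_integral_norm zero_le_one).trans (le_of_eq ?_)
    apply intervalIntegral.integral_congr_ae
    have : ∀ᵐ x : ℝ, x ≠ 1 := by
      simp [MeasureTheory.ae_iff]
    filter_upwards [this] with x hx1 hx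
    rw [uIoc_of_le zero_le_one] at hx
    have hx2 : 0 < 1 - x := by
      have := lt_of_le_of_ne hx.2 hx1
      linarith
    rw [norm_mul, Complex.norm_cpow_eq_rpow_re_of_pos hx.1, ← Complex.ofReal_one,
      ← Complex.ofReal_sub, Complex.norm_cpow_eq_rpow_re_of_pos hx2]
    simp
  have h3 := Complex.Gamma_mul_Gamma_eq_betaIntegral (s := (z.re : ℂ)) (t := (r : ℂ))
    (by simpa using hz) (by simpa using hr)
  rw [h1, ← Complex.ofReal_add, Complex.Gamma_ofReal, Complex.Gamma_ofReal,
    Complex.Gamma_ofReal] at h3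
  have h4 : Real.Gamma z.re * Real.Gamma r = Real.Gamma (z.re + r) *
    ∫ x in (0:ℝ)..1, x ^ (z.re - 1) * (1 - x) ^ (r - 1) := by exact_mod_cast h3
  rw [h4, mul_comm]
  exact mul_le_mul_of_nonneg_left h2 (Real.Gamma_pos_of_pos (by linarith)).le

lemma gamma_mono {z : ℂ} {r : ℝ} (hz : 0 < z.re) (hr : 0 < r) :
    ‖Complex.Gamma z‖ * Real.Gamma (z.re + r) ≤ Real.Gamma z.re * ‖Complex.Gamma (z + r)‖ := by
  have h3 := Complex.Gamma_mul_Gamma_eq_betaIntegral (s := z) (t := (r : ℂ)) hz (by simpa using hr)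
  have h4 := congrArg norm h3
  rw [norm_mul, norm_mul, Complex.Gamma_ofReal, Complex.norm_real, Real.norm_of_nonneg
    (Real.Gamma_pos_of_pos hr).le] at h4
  have h5 := norm_beta_le hz hr
  have hg := Real.Gamma_pos_of_pos hr
  have h6 : (‖Complex.Gamma z‖ * Real.Gamma (z.re + r)) * Real.Gamma r ≤
      (Real.Gamma z.re * ‖Complex.Gamma (z + r)‖) * Real.Gamma r := by
    calc _ = (‖Complex.Gamma z‖ * Real.Gamma r) * Real.Gamma (z.re + r) := by ring
      _ = ‖Complex.Gamma (z + r)‖ * (‖Complex.betaIntegral z r‖ * Real.Gamma (z.re + r)) := by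
        rw [h4]; ring
      _ ≤ ‖Complex.Gamma (z + r)‖ * (Real.Gamma z.re * Real.Gamma r) := by gcongr
      _ = _ := by ring
  exact le_of_mul_le_mul_right h6 hg

lemma gamma_half (y : ℝ) :
    Complex.Gamma (1 / 2 + y * I) * Complex.Gamma (1 / 2 - y * I) = (π / Real.cosh (π * y) : ℝ) := by
  have h := Complex.Gamma_mul_Gamma_one_sub (1 / 2 + y * I)
  have e : (1 : ℂ) - (1 / 2 + y * I) = 1 / 2 - y * I := by ring
  rw [e] at h
  rw [h]
  have : Complex.sin (π * (1 / 2 + y * I)) = Complex.cosh (π * y) := by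
    rw [← Complex.cos_mul_I, ← Complex.sin_pi_div_two_sub, ← Complex.sin_pi_sub]
    congr 1
    ring
  rw [this]
  push_cast
  rfl

lemma gamma_half_norm (y : ℝ) :
    ‖Complex.Gamma (1 / 2 + y * I)‖ ^ 2 = π / Real.cosh (π * y) := by
  have h := gamma_half y
  have e : (1 / 2 - y * I : ℂ) = (starRingEnd ℂ) (1 / 2 + y * I) := by
    simp [Complex.ext_iff]
  rw [e, Complex.Gamma_conj, Complex.mul_conj, Complex.normSq_eq_norm_sq] at h
  exact_mod_cast h

lemma cosh_le (y : ℝ) : Real.cosh y ≤ Real.exp |y| := by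
  rw [← Real.cosh_abs, Real.cosh_eq]
  have : Real.exp (-|y|) ≤ Real.exp |y| := Real.exp_le_exp.2 (by linarith [abs_nonneg y])
  linarith

lemma le_cosh (y : ℝ) : Real.exp |y| / 2 ≤ Real.cosh y := by
  rw [← Real.cosh_abs, Real.cosh_eq]
  linarith [Real.exp_pos (-|y|)]

lemma gamma_half_lower (y : ℝ) :
    Real.exp (-(π / 2) * |y|) ≤ ‖Complex.Gamma (1 / 2 + y * I)‖ := by
  have h := gamma_half_norm y
  apply le_of_sq_le_sq _ (norm_nonneg _)
  rw [h, ← Real.exp_nat_mul, le_div_iff₀ (Real.cosh_pos _)]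
  have h1 := cosh_le (π * y)
  rw [abs_mul, abs_of_pos Real.pi_pos] at h1
  calc _ ≤ Real.exp ((2:ℕ) * (-(π / 2) * |y|)) * Real.exp (π * |y|) := by gcongr
    _ = 1 := by
      rw [← Real.exp_add]
      push_cast
      ring_nf
      simp
    _ ≤ π := by linarith [Real.pi_gt_three]

lemma gamma_half_upper (y : ℝ) :
    ‖Complex.Gamma (1 / 2 + y * I)‖ ≤ π * Real.exp (-(π / 2) * |y|) := by
  have h := gamma_half_norm y
  apply le_of_sq_le_sq _ (by positivity)
  rw [h, mul_pow, ← Real.exp_nat_mul, div_le_iff₀ (Real.cosh_pos _)]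
  have h1 := le_cosh (π * y)
  rw [abs_mul, abs_of_pos Real.pi_pos] at h1
  have h2 : Real.exp ((2:ℕ) * (-(π / 2) * |y|)) * Real.exp (π * |y|) = 1 := by
      rw [← Real.exp_add]
      push_cast
      ring_nf
      simp
  calc π = π * 1 := by ring
    _ ≤ π * (π / 2) := by gcongr; linarith [Real.pi_gt_three]
    _ = π ^ 2 * (Real.exp ((2:ℕ) * (-(π / 2) * |y|)) * (Real.exp (π * |y|) / 2)) := by
      linear_combination (-(π ^ 2) / 2) * h2
    _ ≤ _ := by rw [mul_assoc]; gcongr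

lemma gamma_nat_half_upper (n : ℕ) : ∀ θ : ℝ, θ < π / 2 → ∃ C : ℝ, 0 < C ∧ ∀ y : ℝ,
    ‖Complex.Gamma (n + 1 / 2 + y * I)‖ ≤ C * Real.exp (-θ * |y|) := by
  induction n with
  | zero =>
    intro θ hθ
    refine ⟨π, Real.pi_pos, fun y => ?_⟩
    have := gamma_half_upper y
    simp only [Nat.cast_zero, zero_add]
    refine this.trans ?_
    gcongr
  | succ n ih =>
    intro θ hθ
    obtain ⟨C, hC, h⟩ := ih ((θ + π / 2) / 2) (by linarith)
    set ε := (π / 2 - θ) / 2 with hε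
    have hε0 : 0 < ε := by rw [hε]; linarith
    refine ⟨(n + 1 / 2 + 1 / ε) * C, by positivity, fun y => ?_⟩
    have h0 : (n + 1 / 2 + y * I : ℂ) ≠ 0 := by
      intro h0
      have := congrArg Complex.re h0
      simp at this
      have h2 : (0 : ℝ) ≤ n := n.cast_nonneg
      linarith
    have e : ((n + 1 : ℕ) + 1 / 2 + y * I : ℂ) = (n + 1 / 2 + y * I) + 1 := by push_cast; ring
    rw [e, Complex.Gamma_add_one _ h0, norm_mul]
    have h1 : ‖(n + 1 / 2 + y * I : ℂ)‖ ≤ (n + 1 / 2 + 1 / ε) * Real.exp (ε * |y|) := by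
      have a1 : ‖(n + 1 / 2 + y * I : ℂ)‖ ≤ n + 1 / 2 + |y| := by
        refine (norm_add_le _ _).trans ?_
        gcongr
        · refine (norm_add_le _ _).trans ?_
          simp
        · simp
      have a2 := Real.add_one_le_exp (ε * |y|)
      have a3 : (1:ℝ) ≤ Real.exp (ε * |y|) := Real.one_le_exp (by positivity)
      have a4 : |y| ≤ 1 / ε * Real.exp (ε * |y|) := by
        rw [one_div, ← div_eq_inv_mul, le_div_iff₀ hε0]
        linarith
      have a5 : (n + 1 / 2 : ℝ) ≤ (n + 1 / 2) * Real.exp (ε * |y|) :=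
        le_mul_of_one_le_right (by positivity) a3
      linarith
    calc _ ≤ ((n + 1 / 2 + 1 / ε) * Real.exp (ε * |y|)) * (C * Real.exp (-((θ + π / 2) / 2) * |y|)) := by
          gcongr
          exact h y
      _ = (n + 1 / 2 + 1 / ε) * C * (Real.exp (ε * |y|) * Real.exp (-((θ + π / 2) / 2) * |y|)) := by ring
      _ = _ := by
        rw [← Real.exp_add]
        congr 2
        rw [hε]; ring

lemma gamma_upper {s0 s1 : ℝ} (h0 : 0 < s0) {θ : ℝ} (hθ : θ < π / 2) :
    ∃ C : ℝ, 0 < C ∧ ∀ z : ℂ, s0 ≤ z.re → z.re ≤ s1 →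
    ‖Complex.Gamma z‖ ≤ C * Real.exp (-θ * |z.im|) := by
  obtain ⟨n, hn⟩ := exists_nat_gt s1
  obtain ⟨C, hC, h⟩ := gamma_nat_half_upper n θ hθ
  have hc : ContinuousOn Real.Gamma (Icc s0 s1) := by
    intro s hs
    apply ContinuousAt.continuousWithinAt
    apply DifferentiableAt.continuousAt (𝕜 := ℝ)
    apply Real.differentiableAt_Gamma
    intro m
    have : (0:ℝ) ≤ m := m.cast_nonneg
    linarith [hs.1]
  obtain ⟨M, hM⟩ := isCompact_Icc.exists_bound_of_continuousOn hc
  have hG : 0 < Real.Gamma (n + 1 / 2) := Real.Gamma_pos_of_pos (by positivity)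
  refine ⟨(|M| + 1) / Real.Gamma (n + 1 / 2) * C, by positivity, fun z hz1 hz2 => ?_⟩
  have h1 := gamma_mono (z := z) (r := n + 1 / 2 - z.re) (by linarith) (by linarith)
  have e1 : z.re + (n + 1 / 2 - z.re) = n + 1 / 2 := by ring
  have e2 : z + ((n + 1 / 2 - z.re : ℝ) : ℂ) = n + 1 / 2 + z.im * I := by
    apply Complex.ext <;> simp
  rw [e1, e2, ← le_div_iff₀ hG] at h1
  refine h1.trans ?_
  have h2 := hM z.re ⟨hz1, hz2⟩
  have h3 : Real.Gamma z.re ≤ |M| + 1 := by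
    linarith [le_abs_self M, le_abs_self (Real.Gamma z.re), Real.norm_eq_abs (Real.Gamma z.re)]
  have h4 := h z.im
  calc _ ≤ (|M| + 1) * (C * Real.exp (-θ * |z.im|)) / Real.Gamma (n + 1 / 2) := by gcongr
    _ = _ := by ring

lemma gamma_lower {z : ℂ} (hz : 1 / 2 < z.re) :
    Real.Gamma z.re * Real.exp (-(π / 2) * |z.im|) ≤ 2 * ‖Complex.Gamma z‖ := by
  have h1 := gamma_mono (z := 1 / 2 + z.im * I) (r := z.re - 1 / 2) (by simp) (by linarith)
  have e1 : (1 / 2 + z.im * I : ℂ).re = 1 / 2 := by simp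
  have e2 : 1 / 2 + z.im * I + ((z.re - 1 / 2 : ℝ) : ℂ) = z := by
    conv_rhs => rw [← Complex.re_add_im z]
    push_cast
    ring
  rw [e1, e2, Real.Gamma_one_half_eq] at h1
  have e3 : (1 / 2 : ℝ) + (z.re - 1 / 2) = z.re := by ring
  rw [e3] at h1
  have h2 := gamma_half_lower z.im
  have h3 : √π ≤ 2 := by
    rw [Real.sqrt_le_left (by norm_num)]
    linarith [Real.pi_lt_four]
  have h4 : 0 < Real.Gamma z.re := Real.Gamma_pos_of_pos (by linarith)
  calc _ ≤ Real.Gamma z.re * ‖Complex.Gamma (1 / 2 + z.im * I)‖ := by gcongr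
    _ ≤ √π * ‖Complex.Gamma z‖ := by rw [mul_comm]; exact h1
    _ ≤ _ := by gcongr

lemma integrable_exp_abs {δ : ℝ} (hδ : 0 < δ) : Integrable (fun x : ℝ => Real.exp (-δ * |x|)) := by
  have h1 : IntegrableOn (fun x : ℝ => Real.exp (-δ * |x|)) (Set.Ioi 0) := by
    refine IntegrableOn.congr_fun (exp_neg_integrableOn_Ioi 0 hδ) (fun x hx => ?_) measurableSet_Ioi
    rw [abs_of_pos hx]
  have h2 : IntegrableOn (fun x : ℝ => Real.exp (-δ * |x|)) (Set.Iio 0) := by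
    have := IntegrableOn.comp_neg_Iio (c := 0) (f := fun x : ℝ => Real.exp (-δ * |x|)) (by simpa using h1)
    simpa using this
  rw [← integrableOn_univ, ← Set.Iio_union_Ici (a := (0:ℝ)), integrableOn_union,
    integrableOn_Ici_iff_integrableOn_Ioi]
  exact ⟨h2, h1⟩

lemma integrable_of_bound {f : ℝ → ℂ} (hf : Continuous f) {C δ : ℝ} (hδ : 0 < δ)
    (hb : ∀ x, ‖f x‖ ≤ C * Real.exp (-δ * |x|)) : Integrable f :=
  ((integrable_exp_abs hδ).const_mul C).mono' hf.aestronglyMeasurable (Eventually.of_forall hb)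

lemma contour_shift {f : ℂ → ℂ} {C δ : ℝ} (hδ : 0 < δ)
    (hd : ∀ z : ℂ, -1 / 2 ≤ z.re → z.re ≤ 0 → DifferentiableAt ℂ f z)
    (hb : ∀ z : ℂ, -1 / 2 ≤ z.re → z.re ≤ 0 → ‖f z‖ ≤ C * Real.exp (-δ * |z.im|)) :
    ∫ x : ℝ, f (x * I) = ∫ x : ℝ, f (-1 / 2 + x * I) := by
  have i1 : Integrable (fun x : ℝ => f (x * I)) := by
    refine integrable_of_bound (C := C) ?_ hδ (fun x => ?_)
    · rw [continuous_iff_continuousAt]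
      intro x
      have h1 : ContinuousAt f (x * I) := (hd (x * I) (by simp; norm_num) (by simp)).continuousAt
      exact ContinuousAt.comp (f := fun x : ℝ => (x * I : ℂ)) h1 (by fun_prop)
    · have := hb (x * I) (by simp; norm_num) (by simp)
      simpa using this
  have i2 : Integrable (fun x : ℝ => f (-1 / 2 + x * I)) := by
    refine integrable_of_bound (C := C) ?_ hδ (fun x => ?_)
    · rw [continuous_iff_continuousAt]
      intro x
      have h1 : ContinuousAt f (-1 / 2 + x * I) := (hd _ (by simp) (by simp; norm_num)).continuousAt
      exact ContinuousAt.comp (f := fun x : ℝ => (-1 / 2 + x * I : ℂ)) h1 (by fun_prop)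
    · have := hb (-1 / 2 + x * I) (by simp) (by simp; norm_num)
      simpa using this
  have rect : ∀ T : ℝ, 0 ≤ T →
      (∫ x : ℝ in (-1 / 2)..0, f (x + (-T : ℝ) * I)) - (∫ x : ℝ in (-1 / 2)..0, f (x + T * I)) +
      I * (∫ y : ℝ in (-T)..T, f (y * I)) - I * (∫ y : ℝ in (-T)..T, f (-1 / 2 + y * I)) = 0 := by
    intro T hT
    have := Complex.integral_boundary_rect_eq_zero_of_differentiableOn f (⟨-1 / 2, -T⟩) (⟨0, T⟩) (by
      intro z hz
      rw [mem_reProdIm] at hz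
      have h1 := hz.1
      rw [Set.uIcc_of_le (show (-1 / 2 : ℝ) ≤ 0 by norm_num)] at h1
      exact (hd z h1.1 h1.2).differentiableWithinAt)
    simpa using this
  have hor : ∀ s : ℝ → ℝ, (∀ T, |s T| = |T|) →
      Tendsto (fun T : ℝ => ∫ x : ℝ in (-1 / 2)..0, f (x + (s T : ℝ) * I)) atTop (𝓝 0) := by
    intro s hs
    have hz : Tendsto (fun T : ℝ => C * Real.exp (-δ * T) * |0 - (-1 / 2 : ℝ)|) atTop (𝓝 0) := by
      have : Tendsto (fun T : ℝ => Real.exp (-δ * T)) atTop (𝓝 0) := by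
        apply Real.tendsto_exp_atBot.comp
        exact tendsto_id.const_mul_atTop_of_neg (by linarith)
      simpa using (this.const_mul C).mul_const (|0 - (-1 / 2 : ℝ)|)
    refine squeeze_zero_norm' ?_ hz
    filter_upwards [eventually_ge_atTop 0] with T hT
    apply intervalIntegral.norm_integral_le_of_norm_le_const
    intro x hx
    rw [uIoc_of_le (by norm_num)] at hx
    have := hb (x + s T * I) (by simpa using hx.1.le) (by simpa using hx.2)
    simpa [hs, abs_of_nonneg hT] using this
  have t1 := hor (fun T => -T) (fun T => abs_neg T)
  have t2 := hor (fun T => T) (fun T => rfl)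
  have t3 := intervalIntegral_tendsto_integral i1 tendsto_neg_atTop_atBot tendsto_id
  have t4 := intervalIntegral_tendsto_integral i2 tendsto_neg_atTop_atBot tendsto_id
  have t5 := ((t1.sub t2).add (t3.const_mul I)).sub (t4.const_mul I)
  have t6 := tendsto_nhds_unique (t5.congr' (by
    filter_upwards [eventually_ge_atTop 0] with T hT
    exact rect T hT)) tendsto_const_nhds
  have t7 : I * ((∫ x : ℝ, f (x * I)) - ∫ x : ℝ, f (-1 / 2 + x * I)) = 0 := by
    linear_combination t6
  have t8 := (mul_eq_zero.1 t7).resolve_left Complex.I_ne_zero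
  exact sub_eq_zero.1 t8

/-- decay exponent -/
noncomputable def th : ℝ := 9 * π / 20

lemma gamma_upper' (a : ℂ) {s0 s1 : ℝ} (h0 : 0 < s0) :
    ∃ C : ℝ, 0 < C ∧ ∀ t : ℂ, s0 ≤ (a + t).re → (a + t).re ≤ s1 →
    ‖Complex.Gamma (a + t)‖ ≤ C * Real.exp (-th * |t.im|) := by
  have hth : th < π / 2 := by unfold th; linarith [Real.pi_pos]
  have hth0 : 0 < th := by unfold th; positivity
  obtain ⟨C, hC, h⟩ := gamma_upper (s0 := s0) (s1 := s1) h0 hth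
  refine ⟨C * Real.exp (th * |a.im|), by positivity, fun t h1 h2 => (h _ h1 h2).trans ?_⟩
  rw [mul_assoc, ← Real.exp_add]
  gcongr
  have : |t.im| ≤ |(a + t).im| + |a.im| := by
    have e : t.im = (a + t).im - a.im := by simp
    rw [e]
    exact abs_sub _ _
  nlinarith

lemma norm_sin_le (z : ℂ) : ‖Complex.sin z‖ ≤ Real.exp |z.im| := by
  rw [Complex.sin]
  have h1 : ‖Complex.exp (-z * I)‖ ≤ Real.exp |z.im| := by
    rw [Complex.norm_exp]
    apply Real.exp_le_exp.2
    simpa using le_abs_self z.im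
  have h2 : ‖Complex.exp (z * I)‖ ≤ Real.exp |z.im| := by
    rw [Complex.norm_exp]
    apply Real.exp_le_exp.2
    simpa using neg_le_abs z.im
  rw [norm_div, norm_mul, Complex.norm_I, mul_one]
  have := norm_sub_le (Complex.exp (-z * I)) (Complex.exp (z * I))
  simp only [Complex.norm_ofNat]
  linarith

noncomputable def P (a t : ℂ) : ℂ := Complex.Gamma (a + t) * Complex.Gamma (a - t)

noncomputable def w (t : ℂ) : ℂ := -2 * t * Complex.sin (2 * π * t) / π

noncomputable def F (a b c t : ℂ) : ℂ := P a t * P b t * P c t * w t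

noncomputable def I3 (a b c : ℂ) : ℂ := ∫ x : ℝ, F a b c (x * I)

lemma P_bound {a : ℂ} (ha : 0 < a.re) : ∃ C : ℝ, 0 < C ∧ ∀ x : ℝ,
    ‖P a (x * I)‖ ≤ C * Real.exp (-(2 * th) * |x|) := by
  obtain ⟨C, hC, h⟩ := gamma_upper' a (s0 := a.re) (s1 := a.re) ha
  refine ⟨C * C, by positivity, fun x => ?_⟩
  have h1 := h (x * I) (by simp) (by simp)
  have h2 := h (-(x * I)) (by simp) (by simp)
  simp only [Complex.mul_im, Complex.ofReal_re, Complex.I_im, mul_one, Complex.ofReal_im,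
    Complex.I_re, mul_zero, add_zero, Complex.neg_im, abs_neg] at h1 h2
  rw [P, norm_mul, sub_eq_add_neg]
  calc _ ≤ (C * Real.exp (-th * |x|)) * (C * Real.exp (-th * |x|)) := by gcongr
    _ = C * C * (Real.exp (-th * |x|) * Real.exp (-th * |x|)) := by ring
    _ = _ := by rw [← Real.exp_add]; ring_nf

lemma w_bound (x : ℝ) : ‖w (x * I)‖ ≤ 20 * Real.exp (41 * π / 20 * |x|) := by
  have h1 := norm_sin_le (2 * π * (x * I))
  have e : (2 * π * (x * I) : ℂ).im = 2 * π * x := by simp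
  rw [e, abs_mul, abs_of_pos (by positivity : 0 < 2 * π)] at h1
  have h2 := Real.add_one_le_exp (π / 20 * |x|)
  rw [w, norm_div, norm_mul]
  have e2 : ‖(-2 * (x * I) : ℂ)‖ = 2 * |x| := by simp
  rw [e2, Complex.norm_real, Real.norm_of_nonneg Real.pi_pos.le, div_le_iff₀ Real.pi_pos]
  have hpi := Real.pi_gt_three
  have h3 : 2 * |x| ≤ 20 * π * Real.exp (π / 20 * |x|) := by
    have h0 : 0 ≤ |x| := abs_nonneg x
    have h5 : 20 * π * (π / 20 * |x|) ≤ 20 * π * Real.exp (π / 20 * |x|) := by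
      gcongr
      linarith
    have h6 : 2 * |x| ≤ π * π * |x| := by
      gcongr
      nlinarith
    linarith
  calc _ ≤ (20 * π * Real.exp (π / 20 * |x|)) * Real.exp (2 * π * |x|) := by gcongr
    _ = 20 * π * (Real.exp (π / 20 * |x|) * Real.exp (2 * π * |x|)) := by ring
    _ = _ := by rw [← Real.exp_add]; ring_nf

lemma gamma_diff {z : ℂ} (hz : 0 < z.re) : DifferentiableAt ℂ Complex.Gamma z := by
  apply Complex.differentiableAt_Gamma
  intro m h
  rw [h] at hz
  have : (0:ℝ) ≤ m := m.cast_nonneg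
  simp at hz
  linarith

lemma P_cont {a : ℂ} (ha : 0 < a.re) : Continuous (fun x : ℝ => P a (x * I)) := by
  unfold P
  rw [continuous_iff_continuousAt]
  intro x
  have h1 : ContinuousAt Complex.Gamma (a + x * I) := (gamma_diff (by simpa using ha)).continuousAt
  have h2 : ContinuousAt Complex.Gamma (a - x * I) := (gamma_diff (by simpa using ha)).continuousAt
  exact (ContinuousAt.comp (f := fun x : ℝ => (a + x * I : ℂ)) h1 (by fun_prop)).mul
    (ContinuousAt.comp (f := fun x : ℝ => (a - x * I : ℂ)) h2 (by fun_prop))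

lemma w_cont : Continuous (fun x : ℝ => w (x * I)) := by
  unfold w
  fun_prop

lemma F_integrable {a b c : ℂ} (ha : 0 < a.re) (hb : 0 < b.re) (hc : 0 < c.re) :
    Integrable (fun x : ℝ => F a b c (x * I)) := by
  obtain ⟨A, hA, h1⟩ := P_bound ha
  obtain ⟨B, hB, h2⟩ := P_bound hb
  obtain ⟨C, hC, h3⟩ := P_bound hc
  refine integrable_of_bound (C := A * B * C * 20) (δ := 13 * π / 20) ?_ (by positivity) (fun x => ?_)
  · unfold F
    exact (((P_cont ha).mul (P_cont hb)).mul (P_cont hc)).mul w_cont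
  · rw [F, norm_mul, norm_mul, norm_mul]
    calc _ ≤ (A * Real.exp (-(2 * th) * |x|)) * (B * Real.exp (-(2 * th) * |x|)) *
          (C * Real.exp (-(2 * th) * |x|)) * (20 * Real.exp (41 * π / 20 * |x|)) := by
          gcongr
          · exact h1 x
          · exact h2 x
          · exact h3 x
          · exact w_bound x
      _ = A * B * C * 20 * (Real.exp (-(2 * th) * |x|) * Real.exp (-(2 * th) * |x|) *
          Real.exp (-(2 * th) * |x|) * Real.exp (41 * π / 20 * |x|)) := by ring
      _ = _ := by
        rw [← Real.exp_add, ← Real.exp_add, ← Real.exp_add]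
        unfold th
        ring_nf

noncomputable def Q (a t : ℂ) : ℂ := Complex.Gamma (a + 1 + t) * Complex.Gamma (a - t)

lemma Q_bound {a : ℂ} (ha : 0 < a.re) : ∃ C : ℝ, 0 < C ∧ ∀ z : ℂ, -1 / 2 ≤ z.re → z.re ≤ 0 →
    ‖Q a z‖ ≤ C * Real.exp (-(2 * th) * |z.im|) := by
  obtain ⟨C, hC, h⟩ := gamma_upper' (a + 1) (s0 := a.re) (s1 := a.re + 1) ha
  obtain ⟨D, hD, h'⟩ := gamma_upper' a (s0 := a.re) (s1 := a.re + 1) ha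
  refine ⟨C * D, by positivity, fun z z1 z2 => ?_⟩
  have h1 := h z (by simp; linarith) (by simp; linarith)
  have h2 := h' (-z) (by simp; linarith) (by simp; linarith)
  rw [Complex.neg_im, abs_neg] at h2
  rw [Q, norm_mul, sub_eq_add_neg]
  calc _ ≤ (C * Real.exp (-th * |z.im|)) * (D * Real.exp (-th * |z.im|)) := by gcongr
    _ = C * D * (Real.exp (-th * |z.im|) * Real.exp (-th * |z.im|)) := by ring
    _ = _ := by rw [← Real.exp_add]; ring_nf

lemma Q_diff {a z : ℂ} (ha : 0 < a.re) (z1 : -1 / 2 ≤ z.re) (z2 : z.re ≤ 0) :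
    DifferentiableAt ℂ (Q a) z := by
  have h1 : DifferentiableAt ℂ Complex.Gamma (a + 1 + z) := gamma_diff (by simp; linarith)
  have h2 : DifferentiableAt ℂ Complex.Gamma (a - z) := gamma_diff (by simp; linarith)
  exact (DifferentiableAt.comp (f := fun z => a + 1 + z) z h1 (by fun_prop)).mul
    (DifferentiableAt.comp (f := fun z => a - z) z h2 (by fun_prop))

lemma Q_eq {a t : ℂ} (h : 0 < (a + t).re) : Q a t = (a + t) * P a t := by
  have h0 : a + t ≠ 0 := by
    intro h0
    rw [h0] at h
    simp at h
  rw [Q, P, show a + 1 + t = (a + t) + 1 by ring, Complex.Gamma_add_one _ h0]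
  ring

lemma P_neg (a t : ℂ) : P a (-t) = P a t := by
  rw [P, P, sub_neg_eq_add, mul_comm, sub_eq_add_neg]

lemma P_succ {a t : ℂ} (h : 0 < (a + t).re) (h' : 0 < (a - t).re) :
    P (a + 1) t = (a ^ 2 - t ^ 2) * P a t := by
  have h0 : a + t ≠ 0 := by
    intro h0
    rw [h0] at h
    simp at h
  have h1 : a - t ≠ 0 := by
    intro h0
    rw [h0] at h'
    simp at h'
  rw [P, P, show a + 1 + t = (a + t) + 1 by ring, show a + 1 - t = (a - t) + 1 by ring,
    Complex.Gamma_add_one _ h0, Complex.Gamma_add_one _ h1]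
  ring

lemma Q_refl (a t : ℂ) : Q a (-1 / 2 - t) = Q a (-1 / 2 + t) := by
  rw [Q, Q, mul_comm]
  congr 2 <;> ring

noncomputable def S (a b c t : ℂ) : ℂ := Q a t * Q b t * Q c t * (-Complex.sin (2 * π * t) / π)

lemma S_bound {a b c : ℂ} (ha : 0 < a.re) (hb : 0 < b.re) (hc : 0 < c.re) :
    ∃ C : ℝ, ∀ z : ℂ, -1 / 2 ≤ z.re → z.re ≤ 0 →
    ‖S a b c z‖ ≤ C * Real.exp (-(7 * π / 10) * |z.im|) := by
  obtain ⟨A, hA, h1⟩ := Q_bound ha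
  obtain ⟨B, hB, h2⟩ := Q_bound hb
  obtain ⟨C, hC, h3⟩ := Q_bound hc
  refine ⟨A * B * C, fun z z1 z2 => ?_⟩
  rw [S, norm_mul, norm_mul, norm_mul]
  have h4 : ‖-Complex.sin (2 * π * z) / π‖ ≤ Real.exp (2 * π * |z.im|) := by
    have h1 := norm_sin_le (2 * π * z)
    have e : (2 * π * z : ℂ).im = 2 * π * z.im := by simp
    rw [e, abs_mul, abs_of_pos (by positivity : 0 < 2 * π)] at h1
    rw [norm_div, norm_neg, Complex.norm_real, Real.norm_of_nonneg Real.pi_pos.le]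
    refine (div_le_self (norm_nonneg _) (by linarith [Real.pi_gt_three])).trans h1
  calc _ ≤ (A * Real.exp (-(2 * th) * |z.im|)) * (B * Real.exp (-(2 * th) * |z.im|)) *
          (C * Real.exp (-(2 * th) * |z.im|)) * (Real.exp (2 * π * |z.im|)) := by
          gcongr
          · exact h1 z z1 z2
          · exact h2 z z1 z2
          · exact h3 z z1 z2
      _ = A * B * C * (Real.exp (-(2 * th) * |z.im|) * Real.exp (-(2 * th) * |z.im|) *
          Real.exp (-(2 * th) * |z.im|) * Real.exp (2 * π * |z.im|)) := by ring
      _ = _ := by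
        rw [← Real.exp_add, ← Real.exp_add, ← Real.exp_add]
        unfold th
        ring_nf

lemma S_diff {a b c z : ℂ} (ha : 0 < a.re) (hb : 0 < b.re) (hc : 0 < c.re)
    (z1 : -1 / 2 ≤ z.re) (z2 : z.re ≤ 0) : DifferentiableAt ℂ (S a b c) z := by
  unfold S
  exact (((Q_diff ha z1 z2).mul (Q_diff hb z1 z2)).mul (Q_diff hc z1 z2)).mul (by fun_prop)

lemma S_int_zero {a b c : ℂ} (ha : 0 < a.re) (hb : 0 < b.re) (hc : 0 < c.re) :
    ∫ x : ℝ, S a b c (x * I) = 0 := by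
  obtain ⟨C, hC⟩ := S_bound ha hb hc
  rw [contour_shift (f := S a b c) (C := C) (δ := 7 * π / 10) (by positivity)
    (fun z z1 z2 => S_diff ha hb hc z1 z2) hC]
  have h := integral_neg_eq_self (fun x : ℝ => S a b c (-1 / 2 + x * I)) volume
  have h2 : ∀ x : ℝ, S a b c (-1 / 2 + (-x : ℝ) * I) = - S a b c (-1 / 2 + x * I) := by
    intro x
    have e : (-1 / 2 + (-x : ℝ) * I : ℂ) = -1 / 2 - x * I := by push_cast; ring
    rw [e, S, S, Q_refl, Q_refl, Q_refl]
    have e1 : Complex.sin (2 * π * (-1 / 2 - x * I)) = - Complex.sin (2 * π * (-1 / 2 + x * I)) := by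
      rw [show (2 * π * (-1 / 2 - x * I) : ℂ) = -(2 * π * (x * I)) - π by ring,
        show (2 * π * (-1 / 2 + x * I) : ℂ) = (2 * π * (x * I)) - π by ring,
        Complex.sin_sub_pi, Complex.sin_sub_pi, Complex.sin_neg]
    rw [e1]
    ring
  simp_rw [h2] at h
  rw [integral_neg] at h
  linear_combination (-1 / 2) * h

lemma S_integrable {a b c : ℂ} (ha : 0 < a.re) (hb : 0 < b.re) (hc : 0 < c.re) :
    Integrable (fun x : ℝ => S a b c (x * I)) := by
  obtain ⟨C, hC⟩ := S_bound ha hb hc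
  refine integrable_of_bound (C := C) (δ := 7 * π / 10) ?_ (by positivity) (fun x => ?_)
  · rw [continuous_iff_continuousAt]
    intro x
    have h1 : ContinuousAt (S a b c) (x * I) :=
      (S_diff ha hb hc (by simp; norm_num) (by simp)).continuousAt
    exact ContinuousAt.comp (f := fun x : ℝ => (x * I : ℂ)) h1 (by fun_prop)
  · have := hC (x * I) (by simp; norm_num) (by simp)
    simpa using this

lemma I3_succ {a b c : ℂ} (ha : 0 < a.re) (hb : 0 < b.re) (hc : 0 < c.re) :
    I3 (a + 1) b c = (a + b) * (a + c) * I3 a b c := by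
  have h1 := S_int_zero ha hb hc
  have i1 := S_integrable ha hb hc
  have h2 := integral_neg_eq_self (fun x : ℝ => S a b c (x * I)) volume
  have i2 : Integrable (fun x : ℝ => S a b c ((-x : ℝ) * I)) := i1.comp_neg
  have key : ∀ x : ℝ, S a b c (x * I) + S a b c ((-x : ℝ) * I) =
      (a + b) * (a + c) * F a b c (x * I) - F (a + 1) b c (x * I) := by
    intro x
    have e : (((-x : ℝ) : ℂ) * I) = -(x * I) := by push_cast; ring
    rw [e]
    have hs : Complex.sin (2 * π * (-(x * I))) = - Complex.sin (2 * π * (x * I)) := by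
      rw [← Complex.sin_neg]; congr 1; ring
    rw [S, S, Q_eq (by simpa using ha), Q_eq (by simpa using hb), Q_eq (by simpa using hc),
      Q_eq (by simpa using ha), Q_eq (by simpa using hb), Q_eq (by simpa using hc),
      P_neg, P_neg, P_neg, hs, F, F, P_succ (by simpa using ha) (by simpa using ha), w]
    ring
  have h3 : ∫ x : ℝ, (S a b c (x * I) + S a b c ((-x : ℝ) * I)) = 0 := by
    rw [integral_add i1 i2, h2, h1, add_zero]
  simp_rw [key] at h3
  rw [integral_sub ((F_integrable ha hb hc).const_mul _)
    (F_integrable (by simp; linarith) hb hc), integral_const_mul] at h3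
  rw [I3, I3]
  linear_combination -h3

lemma I3_symm1 (a b c : ℂ) : I3 a b c = I3 b a c := by
  unfold I3 F
  congr 1
  ext x
  ring

lemma I3_symm2 (a b c : ℂ) : I3 a b c = I3 c b a := by
  unfold I3 F
  congr 1
  ext x
  ring

lemma P_bound_unif {s0 s1 : ℝ} (h0 : 0 < s0) : ∃ C : ℝ, 0 < C ∧ ∀ a : ℂ, s0 ≤ a.re → a.re ≤ s1 →
    ∀ x : ℝ, ‖P a (x * I)‖ ≤ C * Real.exp (-th * (|a.im + x| + |a.im - x|)) := by
  have hth : th < π / 2 := by unfold th; linarith [Real.pi_pos]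
  obtain ⟨C, hC, h⟩ := gamma_upper (s0 := s0) (s1 := s1) h0 hth
  refine ⟨C * C, by positivity, fun a a1 a2 x => ?_⟩
  have h1 := h (a + x * I) (by simpa using a1) (by simpa using a2)
  have h2 := h (a - x * I) (by simpa using a1) (by simpa using a2)
  have e1 : (a + x * I).im = a.im + x := by simp
  have e2 : (a - x * I).im = a.im - x := by simp
  rw [e1] at h1
  rw [e2] at h2
  rw [P, norm_mul]
  calc _ ≤ (C * Real.exp (-th * |a.im + x|)) * (C * Real.exp (-th * |a.im - x|)) := by gcongr
    _ = C * C * (Real.exp (-th * |a.im + x|) * Real.exp (-th * |a.im - x|)) := by ring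
    _ = _ := by rw [← Real.exp_add]; ring_nf

lemma abs_aux (s x : ℝ) : 2 * |x| ≤ |s + x| + |s - x| ∧ |s| + |x| ≤ |s + x| + |s - x| := by
  constructor <;>
  · rcases abs_cases s with h1 | h1 <;> rcases abs_cases x with h2 | h2 <;>
    rcases abs_cases (s + x) with h3 | h3 <;> rcases abs_cases (s - x) with h4 | h4 <;> linarith

lemma th_pos : 0 < th := by unfold th; positivity

lemma R_bound {b c : ℂ} (hb : 0 < b.re) (hc : 0 < c.re) : ∃ C : ℝ, 0 < C ∧ ∀ x : ℝ,
    ‖P b (x * I) * P c (x * I) * w (x * I)‖ ≤ C * Real.exp (π / 4 * |x|) := by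
  obtain ⟨B, hB, h2⟩ := P_bound hb
  obtain ⟨C, hC, h3⟩ := P_bound hc
  refine ⟨B * C * 20, by positivity, fun x => ?_⟩
  rw [norm_mul, norm_mul]
  calc _ ≤ (B * Real.exp (-(2 * th) * |x|)) *
          (C * Real.exp (-(2 * th) * |x|)) * (20 * Real.exp (41 * π / 20 * |x|)) := by
          gcongr
          · exact h2 x
          · exact h3 x
          · exact w_bound x
      _ = B * C * 20 * (Real.exp (-(2 * th) * |x|) * Real.exp (-(2 * th) * |x|) *
          Real.exp (41 * π / 20 * |x|)) := by ring
      _ = _ := by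
        rw [← Real.exp_add, ← Real.exp_add]
        unfold th
        ring_nf

lemma I3_bound {b c : ℂ} (hb : 0 < b.re) (hc : 0 < c.re) {s0 s1 : ℝ} (h0 : 0 < s0) :
    ∃ C : ℝ, 0 ≤ C ∧ ∀ a : ℂ, s0 ≤ a.re → a.re ≤ s1 → ‖I3 a b c‖ ≤ C * Real.exp (-th * |a.im|) := by
  obtain ⟨A, hA, h1⟩ := P_bound_unif (s0 := s0) (s1 := s1) h0
  obtain ⟨B, hB, h2⟩ := R_bound hb hc
  have hintg := integrable_exp_abs (δ := π / 5) (by positivity)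
  refine ⟨A * B * ∫ x : ℝ, Real.exp (-(π / 5) * |x|), by positivity, fun a a1 a2 => ?_⟩
  rw [I3]
  have := norm_integral_le_of_norm_le (f := fun x : ℝ => F a b c (x * I))
    (g := fun x : ℝ => A * B * Real.exp (-th * |a.im|) * Real.exp (-(π / 5) * |x|))
    (hintg.const_mul _) (Eventually.of_forall (fun x => ?_))
  · refine this.trans (le_of_eq ?_)
    rw [integral_const_mul]
    ring
  · rw [F, mul_assoc, mul_assoc, ← mul_assoc (P b _), norm_mul]
    have h3 := h1 a a1 a2 x
    have h4 : Real.exp (-th * (|a.im + x| + |a.im - x|)) ≤ Real.exp (-th * (|a.im| + |x|)) := by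
      apply Real.exp_le_exp.2
      have := (abs_aux a.im x).2
      nlinarith [th_pos]
    calc _ ≤ (A * Real.exp (-th * (|a.im| + |x|))) * (B * Real.exp (π / 4 * |x|)) := by
          gcongr
          · exact h3.trans (by gcongr)
          · exact h2 x
      _ = A * B * (Real.exp (-th * (|a.im| + |x|)) * Real.exp (π / 4 * |x|)) := by ring
      _ = A * B * (Real.exp (-th * |a.im|) * Real.exp (-(π / 5) * |x|)) := by
          rw [← Real.exp_add, ← Real.exp_add]
          unfold th
          ring_nf
      _ = _ := by ring

lemma P_hasDeriv {a : ℂ} (ha : 0 < a.re) (x : ℝ) :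
    HasDerivAt (fun a => P a (x * I)) (deriv Complex.Gamma (a + x * I) * Complex.Gamma (a - x * I)
      + Complex.Gamma (a + x * I) * deriv Complex.Gamma (a - x * I)) a := by
  have h1 : HasDerivAt Complex.Gamma (deriv Complex.Gamma (a + x * I)) (a + x * I) :=
    (gamma_diff (by simpa using ha)).hasDerivAt
  have h2 : HasDerivAt Complex.Gamma (deriv Complex.Gamma (a - x * I)) (a - x * I) :=
    (gamma_diff (by simpa using ha)).hasDerivAt
  exact (HasDerivAt.comp_add_const a (x * I) h1).mul (HasDerivAt.comp_sub_const a (x * I) h2)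

lemma gamma_deriv_cont {z : ℂ} (hz : 0 < z.re) : ContinuousAt (deriv Complex.Gamma) z := by
  have ho : IsOpen {z : ℂ | 0 < z.re} := isOpen_lt continuous_const Complex.continuous_re
  have h1 : DifferentiableOn ℂ Complex.Gamma {z : ℂ | 0 < z.re} :=
    fun z hz => (gamma_diff hz).differentiableWithinAt
  exact ((h1.deriv ho).differentiableAt (ho.mem_nhds hz)).continuousAt

lemma I3_diff {a b c : ℂ} (ha : 0 < a.re) (hb : 0 < b.re) (hc : 0 < c.re) :
    DifferentiableAt ℂ (fun a => I3 a b c) a := by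
  obtain ⟨A, hA, h1⟩ := P_bound_unif (s0 := a.re / 2) (s1 := 2 * a.re) (by linarith)
  obtain ⟨B, hB, h2⟩ := R_bound hb hc
  set ρ := a.re / 4 with hρ
  have hρ0 : 0 < ρ := by rw [hρ]; linarith
  have hre : ∀ y ∈ Metric.ball a ρ, |y.re - a.re| < ρ := by
    intro y hy
    rw [Metric.mem_ball, dist_eq_norm] at hy
    have := Complex.abs_re_le_norm (y - a)
    rw [Complex.sub_re] at this
    linarith
  have key := hasDerivAt_integral_of_dominated_loc_of_deriv_le (μ := (volume : Measure ℝ))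
    (F := fun a x => F a b c (x * I))
    (F' := fun a x => (deriv Complex.Gamma (a + x * I) * Complex.Gamma (a - x * I)
      + Complex.Gamma (a + x * I) * deriv Complex.Gamma (a - x * I)) *
        (P b (x * I) * P c (x * I) * w (x * I))) (x₀ := a)
    (bound := fun x => A / ρ * B * Real.exp (-(13 * π / 20) * |x|))
    (s := Metric.ball a ρ) (Metric.ball_mem_nhds a hρ0) ?_ (F_integrable ha hb hc) ?_ ?_ ?_ ?_
  · exact key.2.differentiableAt
  · filter_upwards [Metric.ball_mem_nhds a hρ0] with y hy
    have := abs_lt.1 (hre y hy)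
    exact (F_integrable (by linarith) hb hc).aestronglyMeasurable
  · apply Continuous.aestronglyMeasurable
    refine Continuous.mul ?_ (((P_cont hb).mul (P_cont hc)).mul w_cont)
    rw [continuous_iff_continuousAt]
    intro x
    have g1 : ContinuousAt Complex.Gamma (a + x * I) := (gamma_diff (by simpa using ha)).continuousAt
    have g2 : ContinuousAt Complex.Gamma (a - x * I) := (gamma_diff (by simpa using ha)).continuousAt
    have g3 : ContinuousAt (deriv Complex.Gamma) (a + x * I) := gamma_deriv_cont (by simpa using ha)
    have g4 : ContinuousAt (deriv Complex.Gamma) (a - x * I) := gamma_deriv_cont (by simpa using ha)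
    have c1 : ContinuousAt (fun x : ℝ => (a + x * I : ℂ)) x := by fun_prop
    have c2 : ContinuousAt (fun x : ℝ => (a - x * I : ℂ)) x := by fun_prop
    exact ((ContinuousAt.comp (f := fun x : ℝ => (a + x * I : ℂ)) g3 c1).mul
      (ContinuousAt.comp (f := fun x : ℝ => (a - x * I : ℂ)) g2 c2)).add
      ((ContinuousAt.comp (f := fun x : ℝ => (a + x * I : ℂ)) g1 c1).mul
      (ContinuousAt.comp (f := fun x : ℝ => (a - x * I : ℂ)) g4 c2))
  · refine Eventually.of_forall (fun x y hy => ?_)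
    have hy' := abs_lt.1 (hre y hy)
    have hd := P_hasDeriv (a := y) (by linarith) x
    rw [norm_mul, ← hd.deriv]
    have hC : ‖deriv (fun a => P a (x * I)) y‖ ≤ (A * Real.exp (-(2 * th) * |x|)) / ρ := by
      have hin : ∀ z ∈ Metric.closedBall y ρ, a.re / 2 < z.re ∧ z.re < 2 * a.re := by
        intro z hz
        rw [Metric.mem_closedBall, dist_eq_norm] at hz
        have h3 := Complex.abs_re_le_norm (z - y)
        rw [Complex.sub_re] at h3
        have := abs_le.1 (h3.trans hz)
        constructor <;> linarith
      apply Complex.norm_deriv_le_of_forall_mem_sphere_norm_le hρ0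
      · apply DifferentiableOn.diffContOnCl
        intro z hz
        have := hin z (Metric.closure_ball_subset_closedBall hz)
        exact (P_hasDeriv (by linarith) x).differentiableAt.differentiableWithinAt
      · intro z hz
        have := hin z (Metric.sphere_subset_closedBall hz)
        refine (h1 z this.1.le this.2.le x).trans ?_
        refine mul_le_mul_of_nonneg_left (Real.exp_le_exp.2 ?_) hA.le
        have := (abs_aux z.im x).1
        nlinarith [th_pos]
    calc _ ≤ (A * Real.exp (-(2 * th) * |x|)) / ρ * (B * Real.exp (π / 4 * |x|)) := by
          gcongr
          exact h2 x
      _ = A / ρ * B * (Real.exp (-(2 * th) * |x|) * Real.exp (π / 4 * |x|)) := by ring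
      _ = _ := by
        rw [← Real.exp_add]
        unfold th
        ring_nf
  · exact (integrable_exp_abs (by positivity)).const_mul _
  · refine Eventually.of_forall (fun x y hy => ?_)
    have hy' := abs_lt.1 (hre y hy)
    have hd := P_hasDeriv (a := y) (by linarith) x
    have := hd.mul_const (P b (x * I) * P c (x * I) * w (x * I))
    refine this.congr_of_eventuallyEq (Eventually.of_forall (fun z => ?_))
    simp only [F]
    ring

lemma norm_sin_ge {z : ℂ} (hz : 1 ≤ |z.im|) : Real.exp |z.im| / 4 ≤ ‖Complex.sin z‖ := by
  have h1 : ‖Complex.exp (-z * I)‖ = Real.exp z.im := by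
    rw [Complex.norm_exp]
    simp
  have h2 : ‖Complex.exp (z * I)‖ = Real.exp (-z.im) := by
    rw [Complex.norm_exp]
    simp
  rw [Complex.sin, norm_div, norm_mul, Complex.norm_I, mul_one]
  have h3 := abs_norm_sub_norm_le (Complex.exp (-z * I)) (Complex.exp (z * I))
  rw [h1, h2] at h3
  have h4 : Real.exp |z.im| / 2 ≤ |Real.exp z.im - Real.exp (-z.im)| := by
    have h5 : Real.exp |z.im| - Real.exp (-|z.im|) ≤ |Real.exp z.im - Real.exp (-z.im)| := by
      rcases abs_cases z.im with h | h
      · rw [h.1]; exact le_abs_self _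
      · rw [h.1, neg_neg, abs_sub_comm]; exact le_abs_self _
    have h6 : Real.exp (-|z.im|) ≤ 1 := Real.exp_le_one_iff.2 (by linarith)
    have h7 := Real.add_one_le_exp |z.im|
    linarith
  simp only [Complex.norm_ofNat]
  linarith

lemma entire_periodic_const {G : ℂ → ℂ} (hd : Differentiable ℂ G) (hp : Function.Periodic G 1)
    {C κ : ℝ} (hκ0 : 0 ≤ κ) (hκ : κ < π)
    (hb : ∀ z : ℂ, 1 ≤ z.re → z.re ≤ 2 → ‖G z‖ ≤ C * Real.exp (κ * |z.im|)) (z0 z1 : ℂ) :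
    G z1 = G z0 := by
  set s : ℂ → ℂ := fun z => Complex.sin (π * (z - z0)) with hs
  set u : ℂ → ℂ := fun z => G z - G z0 with hu
  have hud : Differentiable ℂ u := hd.sub_const _
  have hsd : Differentiable ℂ s := by rw [hs]; fun_prop
  have hsderiv : ∀ z, deriv s z = Complex.cos (π * (z - z0)) * π := by
    intro z
    have : HasDerivAt s (Complex.cos (π * (z - z0)) * (π * 1)) z := by
      exact (((hasDerivAt_id z).sub_const z0).const_mul (π : ℂ)).csin
    rw [this.deriv, mul_one]
  have hpi0 : (π : ℂ) ≠ 0 := by exact_mod_cast Real.pi_ne_zero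
  have hs0 : ∀ z, s z = 0 → deriv s z ≠ 0 ∧ u z = 0 := by
    intro z hz
    constructor
    · rw [hsderiv]
      have := Complex.sin_sq_add_cos_sq (π * (z - z0))
      simp only [hs] at hz
      rw [hz] at this
      refine mul_ne_zero (fun h => ?_) hpi0
      rw [h] at this
      norm_num at this
    · simp only [hs] at hz
      obtain ⟨k, hk⟩ := Complex.sin_eq_zero_iff.1 hz
      have h2 : z = z0 + k * 1 := by
        have : (π : ℂ) * (z - z0 - k) = 0 := by linear_combination hk
        have := (mul_eq_zero.1 this).resolve_left hpi0
        linear_combination this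
      simp only [hu]
      rw [h2, hp.int_mul k z0, sub_self]
  set H : ℂ → ℂ := fun z => if s z = 0 then deriv u z / deriv s z else u z / s z with hH
  have hHd : Differentiable ℂ H := by
    intro p
    by_cases hsp : s p = 0
    · have d1 : Differentiable ℂ (dslope u p) := by
        rw [← differentiableOn_univ]
        exact (Complex.differentiableOn_dslope univ_mem).2 hud.differentiableOn
      have d2 : Differentiable ℂ (dslope s p) := by
        rw [← differentiableOn_univ]
        exact (Complex.differentiableOn_dslope univ_mem).2 hsd.differentiableOn
      have n2 : dslope s p p ≠ 0 := by
        rw [dslope_same]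
        exact (hs0 p hsp).1
      refine ((d1 p).div (d2 p) n2).congr_of_eventuallyEq ?_
      filter_upwards [(d2 p).continuousAt.eventually_ne n2] with z hz
      by_cases hzp : z = p
      · subst hzp
        simp only [hH, Pi.div_apply]
        rw [if_pos hsp, dslope_same, dslope_same]
      · have e1 : dslope s p z = (z - p)⁻¹ * s z := by
          rw [dslope_of_ne _ hzp, slope_def_field, hsp]
          ring
        have e2 : dslope u p z = (z - p)⁻¹ * u z := by
          rw [dslope_of_ne _ hzp, slope_def_field, (hs0 p hsp).2]
          ring
        have hsz : s z ≠ 0 := by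
          intro h
          rw [e1, h, mul_zero] at hz
          exact hz rfl
        simp only [hH, Pi.div_apply]
        rw [if_neg hsz, e1, e2]
        have : z - p ≠ 0 := sub_ne_zero.2 hzp
        field_simp
    · refine ((hud p).div (hsd p) hsp).congr_of_eventuallyEq ?_
      filter_upwards [(hsd p).continuousAt.eventually_ne hsp] with z hz
      simp only [hH, Pi.div_apply]
      rw [if_neg hz]
  have hsp1 : ∀ z, s (z + 1) = - s z := by
    intro z
    simp only [hs]
    rw [← Complex.sin_add_pi]
    congr 1
    ring
  have hup1 : ∀ z, u (z + 1) = u z := by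
    intro z
    simp only [hu]
    rw [hp z]
  have hds1 : ∀ z, deriv s (z + 1) = - deriv s z := by
    intro z
    rw [hsderiv, hsderiv, ← neg_mul, ← Complex.cos_add_pi]
    congr 2
    ring
  have hdu1 : ∀ z, deriv u (z + 1) = deriv u z := by
    intro z
    rw [← deriv_comp_add_const]
    congr 1
    ext y
    exact hup1 y
  have hHper : Function.Periodic (fun z => ‖H z‖) 1 := by
    intro z
    simp only [hH]
    rw [hsp1, hup1, hds1, hdu1]
    by_cases h : s z = 0
    · rw [if_pos h, if_pos (by rw [h, neg_zero])]
      simp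
    · rw [if_neg h, if_neg (by simpa using h)]
      simp
  set D : ℝ := (|C| + ‖G z0‖) * (4 * Real.exp (π * |z0.im|)) with hD
  have hD0 : 0 ≤ D := by positivity
  set T : ℝ := 1 + |z0.im| with hT
  have hHb : ∀ z : ℂ, 1 ≤ z.re → z.re ≤ 2 → T ≤ |z.im| →
      ‖H z‖ ≤ D * Real.exp (-(π - κ) * |z.im|) := by
    intro z h1 h2 h3
    have him : |z.im| - |z0.im| ≤ |z.im - z0.im| := abs_sub_abs_le_abs_sub _ _
    have e : (π * (z - z0) : ℂ).im = π * (z.im - z0.im) := by simp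
    have h4 : 1 ≤ |(π * (z - z0) : ℂ).im| := by
      rw [e, abs_mul, abs_of_pos Real.pi_pos]
      nlinarith [Real.pi_gt_three]
    have h5 := norm_sin_ge h4
    rw [e, abs_mul, abs_of_pos Real.pi_pos] at h5
    have h6 : Real.exp (π * |z.im|) / (4 * Real.exp (π * |z0.im|)) ≤ ‖s z‖ := by
      refine le_trans ?_ h5
      rw [mul_comm 4, ← div_div, ← Real.exp_sub]
      gcongr
      nlinarith [Real.pi_pos]
    have h7 : 0 < ‖s z‖ := lt_of_lt_of_le (by positivity) h6
    have h8 : s z ≠ 0 := norm_pos_iff.1 h7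
    have h9 : ‖u z‖ ≤ (|C| + ‖G z0‖) * Real.exp (κ * |z.im|) := by
      have a1 := hb z h1 h2
      have a2 : (1:ℝ) ≤ Real.exp (κ * |z.im|) := Real.one_le_exp (by positivity)
      have a3 : ‖u z‖ ≤ ‖G z‖ + ‖G z0‖ := norm_sub_le _ _
      have a4 : C * Real.exp (κ * |z.im|) ≤ |C| * Real.exp (κ * |z.im|) := by
        gcongr
        exact le_abs_self C
      have a5 : ‖G z0‖ ≤ ‖G z0‖ * Real.exp (κ * |z.im|) := le_mul_of_one_le_right (norm_nonneg _) a2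
      linarith
    simp only [hH]
    rw [if_neg h8, norm_div, div_le_iff₀ h7]
    calc _ ≤ (|C| + ‖G z0‖) * Real.exp (κ * |z.im|) := h9
      _ = D * Real.exp (-(π - κ) * |z.im|) * (Real.exp (π * |z.im|) / (4 * Real.exp (π * |z0.im|))) := by
        rw [hD]
        have : Real.exp (κ * |z.im|) = Real.exp (-(π - κ) * |z.im|) * Real.exp (π * |z.im|) := by
          rw [← Real.exp_add]; ring_nf
        rw [this]
        field_simp
      _ ≤ _ := by gcongr
  obtain ⟨M, hM⟩ := (isCompact_Icc.reProdIm isCompact_Icc : IsCompact (Set.Icc (1:ℝ) 2 ×ℂ Set.Icc (-T) T)).exists_bound_of_continuousOn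
    hHd.continuous.continuousOn
  have hbdd : Bornology.IsBounded (Set.range H) := by
    rw [isBounded_iff_forall_norm_le]
    refine ⟨max M D, ?_⟩
    rintro _ ⟨z, rfl⟩
    have e : ‖H z‖ = ‖H (z - (⌊z.re⌋ - 1 : ℤ) * 1)‖ := (hHper.sub_int_mul_eq (⌊z.re⌋ - 1)).symm
    rw [e]
    set y := z - (⌊z.re⌋ - 1 : ℤ) * 1 with hy
    have y0 : y.re = z.re - ⌊z.re⌋ + 1 := by rw [hy]; simp [-Int.self_sub_floor]; ring
    have y1 : 1 ≤ y.re := by rw [y0]; linarith [Int.floor_le z.re]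
    have y2 : y.re ≤ 2 := by rw [y0]; linarith [Int.lt_floor_add_one z.re]
    by_cases hyT : T ≤ |y.im|
    · refine (hHb y y1 y2 hyT).trans (le_trans ?_ (le_max_right _ _))
      apply mul_le_of_le_one_right hD0
      apply Real.exp_le_one_iff.2
      nlinarith [abs_nonneg y.im]
    · refine (hM y ?_).trans (le_max_left _ _)
      rw [mem_reProdIm]
      exact ⟨⟨y1, y2⟩, abs_le.1 (not_le.1 hyT).le⟩
  have hconst := fun z w => hHd.apply_eq_apply_of_bounded hbdd z w
  have hzero : H 0 = 0 := by
    have ht : Tendsto (fun y : ℝ => D * Real.exp (-(π - κ) * y)) atTop (𝓝 0) := by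
      have : Tendsto (fun y : ℝ => Real.exp (-(π - κ) * y)) atTop (𝓝 0) := by
        apply Real.tendsto_exp_atBot.comp
        exact tendsto_id.const_mul_atTop_of_neg (by linarith)
      simpa using this.const_mul D
    have h0 : ‖H 0‖ ≤ 0 := by
      refine ge_of_tendsto ht ?_
      filter_upwards [eventually_ge_atTop T] with y hy
      have hy0 : 0 ≤ y := by
        have := abs_nonneg z0.im
        linarith
      have := hHb (1 + y * I) (by simp) (by simp) (by simpa [abs_of_nonneg hy0] using hy)
      rw [hconst 0 (1 + y * I)]
      simpa [abs_of_nonneg hy0] using this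
    simpa using h0
  have hz1 := hconst z1 0
  rw [hzero] at hz1
  have : u z1 = 0 := by
    by_cases h : s z1 = 0
    · exact (hs0 z1 h).2
    · simp only [hH] at hz1
      rw [if_neg h, div_eq_zero_iff] at hz1
      exact hz1.resolve_right h
  exact sub_eq_zero.1 this

lemma periodic_const {g : ℂ → ℂ} (hd : ∀ z : ℂ, 0 < z.re → DifferentiableAt ℂ g z)
    (hp : ∀ z : ℂ, 0 < z.re → g (z + 1) = g z)
    {C κ : ℝ} (hκ0 : 0 ≤ κ) (hκ : κ < π)
    (hb : ∀ z : ℂ, 1 ≤ z.re → z.re ≤ 2 → ‖g z‖ ≤ C * Real.exp (κ * |z.im|)) {z0 z1 : ℂ}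
    (h0 : 0 < z0.re) (h1 : 0 < z1.re) : g z1 = g z0 := by
  have hpN : ∀ (n : ℕ) (z : ℂ), 0 < z.re → g (z + n) = g z := by
    intro n
    induction n with
    | zero => intro z _; simp
    | succ n ih =>
      intro z hz
      rw [Nat.cast_succ, ← add_assoc, hp _ (by simp; positivity), ih z hz]
  set G : ℂ → ℂ := fun z => g (z + (⌈|z.re|⌉₊ + 1 : ℕ)) with hG
  have hGN : ∀ (n : ℕ) (z : ℂ), 0 < z.re + n → G z = g (z + n) := by
    intro n z hz
    set m : ℕ := ⌈|z.re|⌉₊ + 1 with hm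
    have hm0 : 0 < z.re + m := by
      have h1 := Nat.le_ceil |z.re|
      have h2 := neg_abs_le z.re
      rw [hm]
      push_cast
      linarith
    have a1 := hpN n (z + m) (by simpa using hm0)
    have a2 := hpN m (z + n) (by simpa using hz)
    simp only [hG]
    rw [← a1, ← a2]
    congr 1
    ring
  have hGg : ∀ z : ℂ, 0 < z.re → G z = g z := by
    intro z hz
    simpa using hGN 0 z (by simpa using hz)
  have hGd : Differentiable ℂ G := by
    intro z
    obtain ⟨n, hn⟩ := exists_nat_gt (-z.re)
    have ho : IsOpen {y : ℂ | 0 < y.re + n} :=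
      isOpen_lt continuous_const (Complex.continuous_re.add continuous_const)
    have hz : 0 < z.re + n := by linarith
    have d : DifferentiableAt ℂ (fun y => g (y + n)) z := by
      have := hd (z + n) (by simpa using hz)
      exact DifferentiableAt.comp (f := fun y : ℂ => y + n) z this (by fun_prop)
    refine d.congr_of_eventuallyEq ?_
    filter_upwards [ho.mem_nhds hz] with y hy
    exact hGN n y hy
  have hGp : Function.Periodic G 1 := by
    intro z
    obtain ⟨n, hn⟩ := exists_nat_gt (-z.re)
    rw [hGN n (z + 1) (by simp; linarith), hGN (n + 1) z (by push_cast; linarith)]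
    congr 1
    push_cast
    ring
  rw [← hGg z0 h0, ← hGg z1 h1]
  refine entire_periodic_const hGd hGp hκ0 hκ (C := C) (fun z a b => ?_) z0 z1
  rw [hGg z (by linarith)]
  exact hb z a b

lemma gamma_low {b : ℂ} (hb : 0 < b.re) : ∃ c : ℝ, 0 < c ∧ ∀ a : ℂ, 1 ≤ a.re → a.re ≤ 2 →
    c * Real.exp (-(π / 2) * |a.im|) ≤ ‖Complex.Gamma (a + b)‖ := by
  have hcont : ContinuousOn Real.Gamma (Set.Icc (1 + b.re) (2 + b.re)) := by
    intro x hx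
    refine (Real.differentiableAt_Gamma ?_).continuousAt.continuousWithinAt
    intro m h
    have : (0:ℝ) ≤ m := m.cast_nonneg
    have := hx.1
    linarith
  obtain ⟨x0, hx0, hm⟩ := isCompact_Icc.exists_isMinOn
    (Set.nonempty_Icc.2 (by linarith : 1 + b.re ≤ 2 + b.re)) hcont
  have hpos : 0 < Real.Gamma x0 := Real.Gamma_pos_of_pos (by linarith [hx0.1])
  refine ⟨Real.Gamma x0 * Real.exp (-(π / 2) * |b.im|) / 2, by positivity, fun a h1 h2 => ?_⟩
  have h3 := gamma_lower (z := a + b) (by simp; linarith)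
  have h4 : Real.Gamma x0 ≤ Real.Gamma (a + b).re := hm (by
    constructor <;> simp <;> linarith)
  have h5 : Real.exp (-(π / 2) * |b.im|) * Real.exp (-(π / 2) * |a.im|) ≤
      Real.exp (-(π / 2) * |(a + b).im|) := by
    rw [← Real.exp_add]
    apply Real.exp_le_exp.2
    have : |(a + b).im| ≤ |a.im| + |b.im| := by
      rw [Complex.add_im]; exact abs_add_le _ _
    nlinarith [Real.pi_pos]
  have h6 : Real.Gamma x0 * (Real.exp (-(π / 2) * |b.im|) * Real.exp (-(π / 2) * |a.im|)) ≤
      Real.Gamma (a + b).re * Real.exp (-(π / 2) * |(a + b).im|) := by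
    gcongr
    exact hpos.le.trans h4
  linarith

noncomputable def G3 (a b c : ℂ) : ℂ :=
  Complex.Gamma (a + b) * Complex.Gamma (a + c) * Complex.Gamma (b + c)

noncomputable def R (a b c : ℂ) : ℂ := I3 a b c / G3 a b c

lemma R_symm1 (a b c : ℂ) : R a b c = R b a c := by
  rw [R, R, I3_symm1, G3, G3, add_comm a b]
  congr 1
  ring

lemma R_symm2 (a b c : ℂ) : R a b c = R c b a := by
  rw [R, R, I3_symm2, G3, G3, add_comm a b, add_comm a c, add_comm b c]
  congr 1
  ring

lemma G3_ne {a b c : ℂ} (ha : 0 < a.re) (hb : 0 < b.re) (hc : 0 < c.re) : G3 a b c ≠ 0 := by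
  have h1 : Complex.Gamma (a + b) ≠ 0 := Complex.Gamma_ne_zero_of_re_pos (by simp; linarith)
  have h2 : Complex.Gamma (a + c) ≠ 0 := Complex.Gamma_ne_zero_of_re_pos (by simp; linarith)
  have h3 : Complex.Gamma (b + c) ≠ 0 := Complex.Gamma_ne_zero_of_re_pos (by simp; linarith)
  exact mul_ne_zero (mul_ne_zero h1 h2) h3

lemma ne_zero_re {z : ℂ} (h : 0 < z.re) : z ≠ 0 := by
  intro h0
  rw [h0] at h
  simp at h

lemma R_const {a a' b c : ℂ} (ha : 0 < a.re) (ha' : 0 < a'.re) (hb : 0 < b.re) (hc : 0 < c.re) :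
    R a b c = R a' b c := by
  obtain ⟨C, hC0, hC⟩ := I3_bound hb hc (s0 := 1) (s1 := 2) one_pos
  obtain ⟨d, hd0, hd⟩ := gamma_low hb
  obtain ⟨e, he0, he⟩ := gamma_low hc
  have hg : 0 < ‖Complex.Gamma (b + c)‖ :=
    norm_pos_iff.2 (Complex.Gamma_ne_zero_of_re_pos (by simp; linarith))
  refine periodic_const (g := fun a => R a b c) (κ := π - th)
    (C := C / (d * e * ‖Complex.Gamma (b + c)‖)) ?_ ?_ ?_ ?_ ?_ ha' ha
  · intro z hz
    refine (I3_diff hz hb hc).div ?_ (G3_ne hz hb hc)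
    unfold G3
    have h1 : DifferentiableAt ℂ Complex.Gamma (z + b) := gamma_diff (by simp; linarith)
    have h2 : DifferentiableAt ℂ Complex.Gamma (z + c) := gamma_diff (by simp; linarith)
    exact ((DifferentiableAt.comp (f := fun z => z + b) z h1 (by fun_prop)).mul
      (DifferentiableAt.comp (f := fun z => z + c) z h2 (by fun_prop))).mul
      (differentiableAt_const _)
  · intro z hz
    have n1 : z + b ≠ 0 := ne_zero_re (by simp; linarith)
    have n2 : z + c ≠ 0 := ne_zero_re (by simp; linarith)
    simp only [R]
    rw [I3_succ hz hb hc, G3, G3, show z + 1 + b = (z + b) + 1 by ring,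
      show z + 1 + c = (z + c) + 1 by ring, Complex.Gamma_add_one _ n1, Complex.Gamma_add_one _ n2]
    rw [show (z + b) * Complex.Gamma (z + b) * ((z + c) * Complex.Gamma (z + c)) *
      Complex.Gamma (b + c) = ((z + b) * (z + c)) *
      (Complex.Gamma (z + b) * Complex.Gamma (z + c) * Complex.Gamma (b + c)) by ring,
      mul_div_mul_left _ _ (mul_ne_zero n1 n2)]
  · unfold th; linarith [Real.pi_pos]
  · linarith [th_pos]
  · intro z z1 z2
    simp only [R, G3]
    rw [norm_div, norm_mul, norm_mul]
    have h1 := hd z z1 z2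
    have h2 := he z z1 z2
    have h3 := hC z z1 z2
    have a1 : 0 < ‖Complex.Gamma (z + b)‖ := lt_of_lt_of_le (by positivity) h1
    have a2 : 0 < ‖Complex.Gamma (z + c)‖ := lt_of_lt_of_le (by positivity) h2
    rw [div_le_iff₀ (mul_pos (mul_pos a1 a2) hg)]
    · calc _ ≤ C * Real.exp (-th * |z.im|) := h3
        _ = C / (d * e * ‖Complex.Gamma (b + c)‖) * Real.exp ((π - th) * |z.im|) *
          ((d * Real.exp (-(π / 2) * |z.im|)) * (e * Real.exp (-(π / 2) * |z.im|)) *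
          ‖Complex.Gamma (b + c)‖) := by
            have : Real.exp (-th * |z.im|) = Real.exp ((π - th) * |z.im|) *
              Real.exp (-(π / 2) * |z.im|) * Real.exp (-(π / 2) * |z.im|) := by
              rw [← Real.exp_add, ← Real.exp_add]; ring_nf
            rw [this]
            field_simp
        _ ≤ _ := by gcongr

lemma R_eq {a b c : ℂ} (ha : 0 < a.re) (hb : 0 < b.re) (hc : 0 < c.re) :
    R a b c = R (1 / 2) 1 (1 / 2) := by
  have h2 : 0 < (1 / 2 : ℂ).re := by norm_num
  have h1 : 0 < (1 : ℂ).re := by norm_num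
  rw [R_const ha h2 hb hc, R_symm1, R_const hb h1 h2 hc, R_symm1, R_symm2,
    R_const hc h2 h1 h2]

noncomputable def J (c : ℂ) : ℂ := ∫ x : ℝ, P c (x * I)

lemma J_shift {c : ℂ} (hc : 0 < c.re) : J (c + 1 / 2) = c * J c := by
  obtain ⟨C, hC0, hC⟩ := Q_bound hc
  have hs := contour_shift (f := Q c) (C := C) (δ := 2 * th) (by linarith [th_pos])
    (fun z z1 z2 => Q_diff hc z1 z2) hC
  have i1 : Integrable (fun x : ℝ => Q c (x * I)) := by
    refine integrable_of_bound (C := C) (δ := 2 * th) ?_ (by linarith [th_pos]) (fun x => ?_)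
    · rw [continuous_iff_continuousAt]
      intro x
      have h1 : ContinuousAt (Q c) (x * I) :=
        (Q_diff hc (by simp; norm_num) (by simp)).continuousAt
      exact ContinuousAt.comp (f := fun x : ℝ => (x * I : ℂ)) h1 (by fun_prop)
    · have := hC (x * I) (by simp; norm_num) (by simp)
      simpa using this
  have h2 := integral_neg_eq_self (fun x : ℝ => Q c (x * I)) volume
  have i2 : Integrable (fun x : ℝ => Q c ((-x : ℝ) * I)) := i1.comp_neg
  have key : ∀ x : ℝ, Q c (x * I) + Q c ((-x : ℝ) * I) = (2 * c) * P c (x * I) := by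
    intro x
    have e : (((-x : ℝ) : ℂ) * I) = -(x * I) := by push_cast; ring
    rw [e, Q_eq (by simpa using hc), Q_eq (by simpa using hc), P_neg]
    ring
  have h3 : ∫ x : ℝ, (Q c (x * I) + Q c ((-x : ℝ) * I)) = 2 * ∫ x : ℝ, Q c (x * I) := by
    rw [integral_add i1 i2, h2]; ring
  simp_rw [key] at h3
  rw [integral_const_mul, hs] at h3
  have e : ∀ x : ℝ, Q c (-1 / 2 + x * I) = P (c + 1 / 2) (x * I) := by
    intro x
    rw [Q, P]
    congr 2 <;> ring
  simp_rw [e] at h3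
  rw [J, J]
  linear_combination (-1 / 2) * h3

lemma J_half : J (1 / 2) = π := by
  unfold J P
  simp_rw [gamma_half]
  rw [integral_complex_ofReal]
  congr 1
  have hintg : Integrable (fun x : ℝ => π / Real.cosh (π * x)) := by
    have h := (integrable_exp_abs Real.pi_pos).const_mul (2 * π)
    refine h.mono' ?_ ?_
    · apply Continuous.aestronglyMeasurable
      exact continuous_const.div (by fun_prop) (fun x => (Real.cosh_pos _).ne')
    · refine Eventually.of_forall fun x => ?_
      have h1 := le_cosh (π * x)
      rw [abs_mul, abs_of_pos Real.pi_pos] at h1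
      have h2 := Real.cosh_pos (π * x)
      rw [Real.norm_of_nonneg (by positivity), div_le_iff₀ h2]
      have h3 : Real.exp (-π * |x|) * Real.exp (π * |x|) = 1 := by
        rw [← Real.exp_add]; simp
      have h4 : 1 / 2 ≤ Real.exp (-π * |x|) * Real.cosh (π * x) := by
        rw [← h3]
        have := mul_le_mul_of_nonneg_left h1 (Real.exp_pos (-π * |x|)).le
        linarith
      nlinarith [Real.pi_pos]
  have hd : ∀ x : ℝ, HasDerivAt (fun x => Real.arctan (Real.sinh (π * x)))
      (π / Real.cosh (π * x)) x := by
    intro x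
    have h1 : HasDerivAt (fun x : ℝ => π * x) π x := by
      simpa using (hasDerivAt_id x).const_mul π
    have h2 := (h1.sinh).arctan
    convert h2 using 1
    have := Real.cosh_sq (π * x)
    have h3 := Real.cosh_pos (π * x)
    rw [show 1 + Real.sinh (π * x) ^ 2 = Real.cosh (π * x) ^ 2 by linarith]
    field_simp
  have hsinh : Tendsto Real.sinh atTop atTop := by
    refine tendsto_atTop_mono' atTop ?_ tendsto_id
    filter_upwards [eventually_ge_atTop 0] with x hx
    exact Real.self_le_sinh_iff.2 hx
  have hsinh' : Tendsto Real.sinh atBot atBot := by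
    refine tendsto_atBot_mono' atBot ?_ tendsto_id
    filter_upwards [eventually_le_atBot 0] with x hx
    exact Real.sinh_le_self_iff.2 hx
  have t1 : Tendsto (fun x => Real.arctan (Real.sinh (π * x))) atTop (𝓝 (π / 2)) :=
    (Real.tendsto_arctan_atTop.mono_right nhdsWithin_le_nhds).comp
      (hsinh.comp (tendsto_id.const_mul_atTop Real.pi_pos))
  have t2 : Tendsto (fun x => Real.arctan (Real.sinh (π * x))) atBot (𝓝 (-(π / 2))) :=
    (Real.tendsto_arctan_atBot.mono_right nhdsWithin_le_nhds).comp
      (hsinh'.comp (tendsto_id.const_mul_atBot Real.pi_pos))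
  rw [integral_of_hasDerivAt_of_tendsto hd hintg t2 t1]
  ring

lemma P_integrable {a : ℂ} (ha : 0 < a.re) : Integrable (fun x : ℝ => P a (x * I)) := by
  obtain ⟨C, _, h⟩ := P_bound ha
  exact integrable_of_bound (P_cont ha) (by linarith [th_pos]) h

/-- value of the weight -/
lemma w_eq (t : ℂ) : w t = 1 / (Complex.Gamma (2 * t) * Complex.Gamma (-(2 * t))) := by
  rcases eq_or_ne t 0 with rfl | ht
  · simp [w, Complex.Gamma_zero]
  have h1 := Complex.Gamma_mul_Gamma_one_sub (2 * t)
  have h2 : Complex.Gamma (-(2 * t) + 1) = -(2 * t) * Complex.Gamma (-(2 * t)) :=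
    Complex.Gamma_add_one _ (by simpa using ht)
  rw [show 1 - 2 * t = -(2 * t) + 1 by ring, h2] at h1
  have h3 : Complex.Gamma (2 * t) * Complex.Gamma (-(2 * t)) =
      π / (-2 * t * Complex.sin (π * (2 * t))) := by
    rw [mul_comm (-2 * t), ← div_div, ← h1]
    field_simp
  rw [h3, one_div_div, w]
  ring_nf

lemma P_half_one (x : ℝ) : P (1 / 2) (x * I) * P 1 (x * I) * w (x * I) = 4 * π * x ^ 2 := by
  rcases eq_or_ne x 0 with rfl | hx
  · simp [w]
  have ht : (x * I : ℂ) ≠ 0 := by simpa using hx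
  set t : ℂ := x * I with htd
  have hs : Complex.sin (π * t) ≠ 0 := by
    rw [htd, ← mul_assoc, ← Complex.ofReal_mul, Complex.sin_mul_I]
    refine mul_ne_zero ?_ I_ne_zero
    rw [← Complex.ofReal_sinh]
    have : Real.sinh (π * x) ≠ 0 := by
      rw [Ne, Real.sinh_eq_zero]; exact mul_ne_zero Real.pi_ne_zero hx
    exact_mod_cast this
  have hc : Complex.cos (π * t) ≠ 0 := by
    rw [htd, ← mul_assoc, ← Complex.ofReal_mul, Complex.cos_mul_I]
    rw [← Complex.ofReal_cosh]
    exact_mod_cast (Real.cosh_pos _).ne'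
  have p1 : P (1 / 2) t = π / Complex.cos (π * t) := by
    rw [P, show (1 / 2 - t : ℂ) = 1 - (1 / 2 + t) by ring, Complex.Gamma_mul_Gamma_one_sub,
      show (π * (1 / 2 + t) : ℂ) = π * t + π / 2 by ring, Complex.sin_add_pi_div_two]
  have p2 : P 1 t = t * (π / Complex.sin (π * t)) := by
    rw [P, add_comm, Complex.Gamma_add_one _ ht, mul_assoc, Complex.Gamma_mul_Gamma_one_sub]
  have p3 : Complex.sin (2 * π * t) = 2 * Complex.sin (π * t) * Complex.cos (π * t) := by
    rw [← Complex.sin_two_mul]; ring_nf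
  have hp : (π : ℂ) ≠ 0 := by exact_mod_cast Real.pi_ne_zero
  rw [p1, p2, w, p3]
  have : (x : ℂ) ^ 2 = - t ^ 2 := by rw [htd, mul_pow, I_sq]; ring
  rw [this]
  field_simp
  ring

lemma I3_base : I3 (1 / 2) 1 (1 / 2) = π ^ 2 := by
  have h2 : 0 < (1 / 2 : ℂ).re := by norm_num
  have h1 : 0 < (1 : ℂ).re := by norm_num
  have e : ∀ x : ℝ, F (1 / 2) 1 (1 / 2) (x * I) =
      4 * π * (P (1 / 2 + 1) (x * I) - 1 / 4 * P (1 / 2) (x * I)) := by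
    intro x
    rw [P_succ (by simp) (by simp), F]
    have h := P_half_one x
    have : (x * I : ℂ) ^ 2 = - x ^ 2 := by rw [mul_pow, I_sq]; ring
    rw [this]
    linear_combination P (1 / 2) (x * I) * h
  rw [I3]
  simp_rw [e]
  rw [integral_const_mul, integral_sub (P_integrable (by norm_num))
    ((P_integrable h2).const_mul _), integral_const_mul]
  change 4 * π * (J (1 / 2 + 1) - 1 / 4 * J (1 / 2)) = _
  have j1 := J_shift h1
  have j2 := J_shift h2
  rw [show (1 / 2 + 1 / 2 : ℂ) = 1 by norm_num] at j2
  rw [add_comm (1 / 2 : ℂ) 1, j1, j2, J_half]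
  ring

lemma I3_eval {a b c : ℂ} (ha : 0 < a.re) (hb : 0 < b.re) (hc : 0 < c.re) :
    I3 a b c = 4 * π * G3 a b c := by
  have h := R_eq ha hb hc
  have hg : Complex.Gamma (1 / 2 + 1) * Complex.Gamma (1 / 2 + 1) = π / 4 := by
    rw [Complex.Gamma_add_one _ (by norm_num)]
    have := Complex.Gamma_mul_Gamma_one_sub (1 / 2)
    rw [show (1 - 1 / 2 : ℂ) = 1 / 2 by norm_num, show (π * (1 / 2) : ℂ) = π / 2 by ring,
      Complex.sin_pi_div_two] at this
    linear_combination (1 / 4) * this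
  have hG : G3 (1 / 2) 1 (1 / 2) = π / 4 := by
    rw [G3, show (1 / 2 + 1 / 2 : ℂ) = 1 by norm_num, Complex.Gamma_one, add_comm (1 : ℂ) (1 / 2),
      mul_one, hg]
  have hp : (π : ℂ) ≠ 0 := by exact_mod_cast Real.pi_ne_zero
  rw [R, R, I3_base, hG, div_eq_iff (G3_ne ha hb hc)] at h
  rw [h]
  field_simp

end Gust

/-- The degenerate case of Gustafson's first beta-type identity.
Since `Re α_j > 0`, the contour `C₀` separating the pole families
`{-α_i - nℏ}` from `{α_i + nℏ}` can be taken to be the imaginary axis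
`t = iτ`, `τ ∈ ℝ`, with the appropriately normalized measure `dτ/(4πℏ)`. -/
theorem gustafson_degenerate
    (h : ℝ) (hh : 0 < h) (α : Fin 3 → ℂ) (hα : ∀ j, 0 < (α j).re) :
    (1 / (4 * (π : ℂ) * (h : ℂ))) *
      ∫ τ : ℝ,
        (∏ j : Fin 3,
          Gamma1 (α j + Complex.I * (τ : ℂ)) h * Gamma1 (α j - Complex.I * (τ : ℂ)) h)
        / (Gamma1 (2 * Complex.I * (τ : ℂ)) h * Gamma1 (-(2 * Complex.I * (τ : ℂ))) h)
    = ∏ p ∈ Finset.univ.filter (fun p : Fin 3 × Fin 3 => p.1 < p.2),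
        Gamma1 (α p.1 + α p.2) h := by
  have hc : (h : ℂ) ≠ 0 := by exact_mod_cast hh.ne'
  have hp : (π : ℂ) ≠ 0 := by exact_mod_cast Real.pi_ne_zero
  have hre : ∀ j, 0 < (α j / h).re := by
    intro j
    rw [Complex.div_ofReal_re]
    exact div_pos (hα j) hh
  set K : ℂ := (h : ℂ) ^ (2 * α 0 / h) * (h : ℂ) ^ (2 * α 1 / h) * (h : ℂ) ^ (2 * α 2 / h) with hK
  have pair : ∀ (a : ℂ) (τ : ℝ), Gamma1 (a + Complex.I * τ) h * Gamma1 (a - Complex.I * τ) h =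
      (h : ℂ) ^ (2 * a / h) * Gust.P (a / h) ((τ / h : ℝ) * I) := by
    intro a τ
    have e1 : (a + Complex.I * τ) / h = a / h + (τ / h : ℝ) * I := by push_cast; ring
    have e2 : (a - Complex.I * τ) / h = a / h - (τ / h : ℝ) * I := by push_cast; ring
    have e3 : (2 * a / h : ℂ) = (a / h + (τ / h : ℝ) * I) + (a / h - (τ / h : ℝ) * I) := by ring
    rw [Gamma1, Gamma1, e1, e2, e3, Complex.cpow_add (a / h + (τ / h : ℝ) * I)
      (a / h - (τ / h : ℝ) * I) hc, Gust.P]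
    ring
  have den : ∀ τ : ℝ, Gamma1 (2 * Complex.I * τ) h * Gamma1 (-(2 * Complex.I * τ)) h =
      Complex.Gamma (2 * ((τ / h : ℝ) * I)) * Complex.Gamma (-(2 * ((τ / h : ℝ) * I))) := by
    intro τ
    have e1 : (2 * Complex.I * τ) / h = 2 * ((τ / h : ℝ) * I) := by push_cast; ring
    have e2 : -(2 * Complex.I * τ) / h = -(2 * ((τ / h : ℝ) * I)) := by push_cast; ring
    rw [Gamma1, Gamma1, e1, e2, mul_mul_mul_comm, ← Complex.cpow_add _ _ hc, add_neg_cancel,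
      Complex.cpow_zero, one_mul]
  have integrand : ∀ τ : ℝ, (∏ j : Fin 3,
          Gamma1 (α j + Complex.I * (τ : ℂ)) h * Gamma1 (α j - Complex.I * (τ : ℂ)) h)
        / (Gamma1 (2 * Complex.I * (τ : ℂ)) h * Gamma1 (-(2 * Complex.I * (τ : ℂ))) h) =
      K * Gust.F (α 0 / h) (α 1 / h) (α 2 / h) ((τ / h : ℝ) * I) := by
    intro τ
    rw [den, Fin.prod_univ_three, pair, pair, pair, Gust.F, Gust.w_eq, hK]
    ring
  simp_rw [integrand]
  rw [integral_const_mul,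
    Measure.integral_comp_div (fun x : ℝ => Gust.F (α 0 / h) (α 1 / h) (α 2 / h) (x * I)) h]
  have hI := Gust.I3_eval (hre 0) (hre 1) (hre 2)
  rw [Gust.I3] at hI
  rw [hI, abs_of_pos hh, Complex.real_smul]
  have hf : Finset.univ.filter (fun p : Fin 3 × Fin 3 => p.1 < p.2) =
      {((0 : Fin 3), (1 : Fin 3)), (0, 2), (1, 2)} := by decide
  rw [hf, Finset.prod_insert (by decide), Finset.prod_insert (by decide), Finset.prod_singleton]
  simp only [Gamma1, Gust.G3, add_div]
  have hK2 : K = (h : ℂ) ^ (α 0 / h + α 1 / h) * (h : ℂ) ^ (α 0 / h + α 2 / h) *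
      (h : ℂ) ^ (α 1 / h + α 2 / h) := by
    rw [hK, ← Complex.cpow_add _ _ hc, ← Complex.cpow_add _ _ hc, ← Complex.cpow_add _ _ hc,
      ← Complex.cpow_add _ _ hc]
    congr 1
    ring
  rw [hK2]
  field_simp
end

section
/- Zeta-regularized tangent determinant at fixed points: for n ∈ Z_{≥0} and ℏ, a > 0, the regularized product [∏_{m ∈ Z_{≥0}, m ≠ n} (ℏ/2π)(m − n)]_a, defined by −∂_s(Σ_{m=1}^n e^{−iπs}(aℏm/2π)^{−s} + Σ_{m=1}^∞ (aℏm/2π)^{−s})|_{s=0}, equals (−1)^n (aℏ/2π)^n n! · (2π/√(aℏ)). Equivalently, its reciprocal is (−1)^n (aℏ/2π)^{−n} (1/n!) · √(aℏ)/(2π). -/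
open Complex Real Finset

/-- the zeta-regularized tangent determinant at the `n`-th fixed
point.  The function
`Z(s) = e^{-iπs} Σ_{m=1}^n (aℏm/2π)^{-s} + (aℏ/2π)^{-s} ζ(s)`
is the analytic continuation of
`Σ_{m=1}^n e^{-iπs}(aℏm/2π)^{-s} + Σ_{m=1}^∞ (aℏm/2π)^{-s}`, and the
regularized product `[∏_{m∈Z_{≥0}, m≠n} (ℏ/2π)(m-n)]_a := exp(-Z'(0))`
equals `(-1)^n (aℏ/2π)^n n! (2π/√(aℏ))`. -/
theorem regularized_tangent_determinant
    (n : ℕ) (h a : ℝ) (hh : 0 < h) (ha : 0 < a) :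
    let Z : ℂ → ℂ := fun s =>
      Complex.exp (-(Complex.I * (π : ℂ) * s)) *
        (∑ m ∈ Finset.range n, ((a * h * (m + 1) / (2 * π) : ℝ) : ℂ) ^ (-s))
      + ((a * h / (2 * π) : ℝ) : ℂ) ^ (-s) * riemannZeta s
    Complex.exp (-(deriv Z 0)) =
      (-1 : ℂ) ^ n * ((a * h / (2 * π) : ℝ) : ℂ) ^ n * (n.factorial : ℂ) *
        (2 * (π : ℂ) / (Real.sqrt (a * h) : ℂ)) := by
  intro Z
  have hpi : (0 : ℝ) < 2 * π := by positivity
  have hc : (0 : ℝ) < a * h / (2 * π) := by positivity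
  have hcm : ∀ m : ℕ, (0 : ℝ) < a * h * (m + 1) / (2 * π) := fun m => by positivity
  have hpow : ∀ c : ℝ, 0 < c →
      HasDerivAt (fun s : ℂ => (c : ℂ) ^ (-s)) (-((Real.log c : ℝ) : ℂ)) 0 := by
    intro c hc
    have h1 := ((hasDerivAt_id (0 : ℂ)).neg).const_cpow (c := (c : ℂ))
      (Or.inl (by exact_mod_cast hc.ne'))
    simpa [Complex.ofReal_log hc.le] using h1
  have hexp : HasDerivAt (fun s : ℂ => Complex.exp (-(Complex.I * (π : ℂ) * s)))
      (-(Complex.I * π)) 0 := by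
    have h1 := (((hasDerivAt_id (0 : ℂ)).const_mul (Complex.I * (π : ℂ))).neg).cexp
    simpa using h1
  have hsum : HasDerivAt
      (fun s : ℂ => ∑ m ∈ Finset.range n, ((a * h * (m + 1) / (2 * π) : ℝ) : ℂ) ^ (-s))
      (∑ m ∈ Finset.range n, -((Real.log (a * h * (m + 1) / (2 * π)) : ℝ) : ℂ)) 0 :=
    HasDerivAt.fun_sum fun m _ => hpow _ (hcm m)
  have hz : HasDerivAt riemannZeta (-((Real.log (2 * π) : ℝ) : ℂ) / 2) 0 := by
    have h1 := (differentiableAt_riemannZeta (s := 0) (by norm_num)).hasDerivAt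
    rw [deriv_riemannZeta_zero] at h1
    rw [Complex.ofReal_log hpi.le]
    simpa using h1
  have hZ : HasDerivAt Z _ 0 := (hexp.mul hsum).add ((hpow _ hc).mul hz)
  rw [hZ.deriv]
  have hprod : ∏ m ∈ Finset.range n, ((a * h * (m + 1) / (2 * π) : ℝ) : ℂ)
      = ((a * h / (2 * π) : ℝ) : ℂ) ^ n * (n.factorial : ℂ) := by
    rw [← Finset.prod_range_add_one_eq_factorial]
    push_cast
    rw [← Finset.card_range n, ← Finset.prod_const, Finset.card_range,
      ← Finset.prod_mul_distrib]
    refine Finset.prod_congr rfl fun m _ => ?_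
    ring
  have hsq : Complex.exp (((-(Real.log (a * h / (2 * π))) / 2 + Real.log (2 * π) / 2 : ℝ)) : ℂ)
      = 2 * (π : ℂ) / (Real.sqrt (a * h) : ℂ) := by
    have hah : 0 < a * h := by positivity
    have : -(Real.log (a * h / (2 * π))) / 2 + Real.log (2 * π) / 2
        = Real.log (2 * π / Real.sqrt (a * h)) := by
      rw [Real.log_div hah.ne' hpi.ne', Real.log_div hpi.ne' (Real.sqrt_pos.2 hah).ne',
        Real.log_sqrt hah.le]
      ring
    rw [this, ← Complex.ofReal_exp, Real.exp_log (div_pos hpi (Real.sqrt_pos.2 hah))]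
    push_cast
    rfl
  have hI : Complex.exp ((n : ℂ) * (π * Complex.I)) = (-1) ^ n := by
    rw [Complex.exp_nat_mul, Complex.exp_pi_mul_I]
  have hlog : Complex.exp (∑ m ∈ Finset.range n,
      ((Real.log (a * h * (m + 1) / (2 * π)) : ℝ) : ℂ))
      = ∏ m ∈ Finset.range n, ((a * h * (m + 1) / (2 * π) : ℝ) : ℂ) := by
    rw [Complex.exp_sum]
    refine Finset.prod_congr rfl fun m _ => ?_
    rw [← Complex.ofReal_exp, Real.exp_log (hcm m)]
  rw [mul_assoc ((-1 : ℂ) ^ n), ← hprod, ← hlog, ← hI, ← hsq, ← Complex.exp_add,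
    ← Complex.exp_add]
  congr 1
  rw [riemannZeta_zero, Finset.sum_neg_distrib]
  simp only [neg_zero, mul_zero, Complex.cpow_zero, Complex.exp_zero, Finset.sum_const,
    Finset.card_range, nsmul_eq_mul, mul_one, one_mul, Complex.ofReal_add, Complex.ofReal_div,
    Complex.ofReal_neg, Complex.ofReal_ofNat]
  ring
end
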